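/- arXiv:2008.07846 — 9 statements merged into one kernel-verified Lean document; each statement's English description precedes it below -/
import Mathlib

section
/- Let K be a field with an involutive automorphism ι (possibly the identity), let (Ĝ, π) be a C₂-graded finite group, let (V, (B_w)) be a hermitian K-representation of (Ĝ, π), and let W ⊆ V be a subrepresentation. For an odd element w, let W^⊥ := {v ∈ V : B_w(u, v) = 0 for all u ∈ W} be the right orthogonal complement of W with respect to B_w. Then: (1) W^⊥ does not depend on the choice of odd element w; (2) W^⊥ is a G-invariant subspace; (3) every restricted form B_w|_{W^⊥ × W^⊥} is nondegenerate, so W^⊥ is a subrepresentation; and (4) V = W ⊕ W^⊥ (internal direct sum of vector spaces). -/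
open scoped ComplexConjugate

noncomputable section Defs

variable {Ghat : Type} [Group Ghat]

/-- Conjugate `g ∈ G = ker π` by an arbitrary element `w` of the graded group. -/
def conjKer (π : Ghat →* ℤˣ) (w : Ghat) (g : π.ker) : π.ker :=
  ⟨w * (g : Ghat) * w⁻¹, by
    have hg : π (g : Ghat) = 1 := g.2
    simp [MonoidHom.mem_ker, map_mul, map_inv, hg]⟩

/-- The square `w²` of any element lies in `G = ker π`. -/
def sqKer (π : Ghat →* ℤˣ) (w : Ghat) : π.ker :=
  ⟨w * w, by simp [MonoidHom.mem_ker, map_mul, Int.units_mul_self]⟩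

/-- For odd `w₁, w₂`, the element `w₂ w₁⁻¹` lies in `G = ker π`. -/
def ratioKer (π : Ghat →* ℤˣ) (w₂ w₁ : Ghat) (h₂ : π w₂ = -1) (h₁ : π w₁ = -1) : π.ker :=
  ⟨w₂ * w₁⁻¹, by simp [MonoidHom.mem_ker, map_mul, map_inv, h₁, h₂]⟩

/-- A family of forms `B w` (for odd `w`) making the `G`-representation `ρ` into a
hermitian `K`-representation of the `C₂`-graded group `(Ghat, π)` with respect to the
ring involution `ι` of `K`:  each `B w` is `ι`-sesquilinear, nondegenerate, `w`-invariant,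
`w`-hermitian, and the various forms are compatible. -/
structure IsHermRep (K : Type) [Field K] (ι : K →+* K) (π : Ghat →* ℤˣ)
    {V : Type} [AddCommGroup V] [Module K V]
    (ρ : Representation K π.ker V) (B : Ghat → V → V → K) : Prop where
  add_left : ∀ w, π w = -1 → ∀ u u' v : V, B w (u + u') v = B w u v + B w u' v
  smul_left : ∀ w, π w = -1 → ∀ (a : K) (u v : V), B w (a • u) v = ι a * B w u v
  add_right : ∀ w, π w = -1 → ∀ u v v' : V, B w u (v + v') = B w u v + B w u v'
  smul_right : ∀ w, π w = -1 → ∀ (a : K) (u v : V), B w u (a • v) = a * B w u v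
  nondeg_left : ∀ w, π w = -1 → ∀ u : V, (∀ v, B w u v = 0) → u = 0
  nondeg_right : ∀ w, π w = -1 → ∀ v : V, (∀ u, B w u v = 0) → v = 0
  invariant : ∀ w, π w = -1 → ∀ (g : π.ker) (u v : V),
      B w (ρ g u) (ρ (conjKer π w g) v) = B w u v
  hermitian : ∀ w, π w = -1 → ∀ u v : V, B w u (ρ (sqKer π w) v) = ι (B w v u)
  compat : ∀ w₁ w₂ (h₁ : π w₁ = -1) (h₂ : π w₂ = -1) (u v : V),
      B w₁ u v = B w₂ u (ρ (ratioKer π w₂ w₁ h₂ h₁) v)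

/-- The right orthogonal complement of `W` with respect to the form `B w`. -/
def perp {K : Type} [Field K] {V : Type} [AddCommGroup V] [Module K V]
    (B : Ghat → V → V → K) (W : Submodule K V) (w : Ghat) : Set V :=
  {v : V | ∀ u ∈ W, B w u v = 0}

/-- `W` is a subrepresentation: a `G`-invariant subspace on which every restricted
form is nondegenerate. -/
def IsSubrep (K : Type) [Field K] (π : Ghat →* ℤˣ)
    {V : Type} [AddCommGroup V] [Module K V]
    (ρ : Representation K π.ker V) (B : Ghat → V → V → K) (W : Submodule K V) : Prop :=
  (∀ (g : π.ker), ∀ v ∈ W, ρ g v ∈ W) ∧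
  ∀ w, π w = -1 →
    (∀ u ∈ W, (∀ v ∈ W, B w u v = 0) → u = 0) ∧
    (∀ v ∈ W, (∀ u ∈ W, B w u v = 0) → v = 0)

/-- The hermitian representation `(V, B)` is irreducible. -/
def IsIrredRep (K : Type) [Field K] (π : Ghat →* ℤˣ)
    {V : Type} [AddCommGroup V] [Module K V]
    (ρ : Representation K π.ker V) (B : Ghat → V → V → K) : Prop :=
  (∃ v : V, v ≠ 0) ∧ ∀ W : Submodule K V, IsSubrep K π ρ B W → W = ⊥ ∨ W = ⊤

/-- `W` is an irreducible subrepresentation. -/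
def IsIrredSubrep (K : Type) [Field K] (π : Ghat →* ℤˣ)
    {V : Type} [AddCommGroup V] [Module K V]
    (ρ : Representation K π.ker V) (B : Ghat → V → V → K) (W : Submodule K V) : Prop :=
  IsSubrep K π ρ B W ∧ W ≠ ⊥ ∧
    ∀ U : Submodule K V, U ≤ W → IsSubrep K π ρ B U → U = ⊥ ∨ U = W

/-- `W` is a `G`-invariant subspace that is simple as a `KG`-module. -/
def IsSimpleGSub (K : Type) [Field K] (π : Ghat →* ℤˣ)
    {V : Type} [AddCommGroup V] [Module K V]
    (ρ : Representation K π.ker V) (W : Submodule K V) : Prop :=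
  (∀ (g : π.ker), ∀ v ∈ W, ρ g v ∈ W) ∧ W ≠ ⊥ ∧
    ∀ U : Submodule K V, U ≤ W → (∀ (g : π.ker), ∀ v ∈ U, ρ g v ∈ U) → U = ⊥ ∨ U = W

/-- The group of automorphisms of a hermitian representation: the `G`-equivariant linear
automorphisms preserving every form `B w`. -/
def AutRep (K : Type) [Field K] (π : Ghat →* ℤˣ)
    {V : Type} [AddCommGroup V] [Module K V]
    (ρ : Representation K π.ker V) (B : Ghat → V → V → K) : Subgroup (V ≃ₗ[K] V) where
  carrier := {f | (∀ (g : π.ker) (v : V), f (ρ g v) = ρ g (f v)) ∧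
      ∀ w, π w = -1 → ∀ u v : V, B w (f u) (f v) = B w u v}
  one_mem' := ⟨fun _ _ => rfl, fun _ _ _ _ => rfl⟩
  mul_mem' := by
    rintro f g ⟨hf1, hf2⟩ ⟨hg1, hg2⟩
    refine ⟨fun a v => ?_, fun w hw u v => ?_⟩
    · show f (g (ρ a v)) = ρ a (f (g v))
      rw [hg1, hf1]
    · show B w (f (g u)) (f (g v)) = B w u v
      rw [hf2 w hw, hg2 w hw]
  inv_mem' := by
    rintro f ⟨hf1, hf2⟩
    refine ⟨fun g v => ?_, fun w hw u v => ?_⟩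
    · apply f.injective
      show f (f.symm (ρ g v)) = f (ρ g (f.symm v))
      rw [f.apply_symm_apply, hf1, f.apply_symm_apply]
    · show B w (f.symm u) (f.symm v) = B w u v
      conv_rhs => rw [← f.apply_symm_apply u, ← f.apply_symm_apply v]
      exact (hf2 w hw _ _).symm

/-- Linear (`L`-) representations: the hermitian theory over `ℂ` with the trivial involution. -/
abbrev IsLRep (π : Ghat →* ℤˣ) {V : Type} [AddCommGroup V] [Module ℂ V]
    (ρ : Representation ℂ π.ker V) (B : Ghat → V → V → ℂ) : Prop :=
  IsHermRep ℂ (RingHom.id ℂ) π ρ B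

/-- Hermitian (`H`-) representations: the hermitian theory over `ℂ` with complex conjugation. -/
abbrev IsHRep (π : Ghat →* ℤˣ) {V : Type} [AddCommGroup V] [Module ℂ V]
    (ρ : Representation ℂ π.ker V) (B : Ghat → V → V → ℂ) : Prop :=
  IsHermRep ℂ (starRingEnd ℂ) π ρ B

/-- An antilinear (`A`-) representation of the `C₂`-graded group `(Ghat, π)`: an action of the
whole group `Ghat` by additive automorphisms in which even elements act `ℂ`-linearly and odd
elements act conjugate-linearly. -/
structure IsARep (π : Ghat →* ℤˣ) {V : Type} [AddCommGroup V] [Module ℂ V]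
    (a : Ghat → V → V) : Prop where
  map_add : ∀ (z : Ghat) (u v : V), a z (u + v) = a z u + a z v
  map_smul_even : ∀ z, π z = 1 → ∀ (c : ℂ) (v : V), a z (c • v) = c • a z v
  map_smul_odd : ∀ z, π z = -1 → ∀ (c : ℂ) (v : V), a z (c • v) = (starRingEnd ℂ c) • a z v
  map_one : ∀ v : V, a 1 v = v
  map_mul : ∀ (z₁ z₂ : Ghat) (v : V), a (z₁ * z₂) v = a z₁ (a z₂ v)

/-- The componentwise action of `G` on the direct sum `V^{⊕n}`. -/
def piRep (π : Ghat →* ℤˣ) {V : Type} [AddCommGroup V] [Module ℂ V]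
    (ρ : Representation ℂ π.ker V) (n : ℕ) : Representation ℂ π.ker (Fin n → V) where
  toFun g := LinearMap.pi fun i => (ρ g) ∘ₗ LinearMap.proj i
  map_one' := by
    ext v i
    simp
  map_mul' g h := by
    ext v i
    simp

/-- The orthogonal sum of the forms `B w` on the direct sum `V^{⊕n}`. -/
def sumForm {V : Type} [AddCommGroup V] [Module ℂ V]
    (B : Ghat → V → V → ℂ) (n : ℕ) : Ghat → (Fin n → V) → (Fin n → V) → ℂ :=
  fun w u v => ∑ i, B w (u i) (v i)

/-- The bilinear forms `B_w(u,v) = ⟨u, w⁻¹·v⟩ + ⟨v, w·u⟩` associated with an invariant inner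
product on an `A`-representation. -/
def assocForm {V : Type} [AddCommGroup V] [Module ℂ V]
    (a : Ghat → V → V) (h : V → V → ℂ) : Ghat → V → V → ℂ :=
  fun w u v => h u (a w⁻¹ v) + h v (a w u)

end Defs

namespace IsHermRep

variable {K : Type} [Field K] {ι : K →+* K} {Ghat : Type} [Group Ghat] {π : Ghat →* ℤˣ}
  {V : Type} [AddCommGroup V] [Module K V] {ρ : Representation K π.ker V}
  {B : Ghat → V → V → K}

/-- The linear functional `B w u ·`. -/
def rightLinear (hB : IsHermRep K ι π ρ B) {w : Ghat} (hw : π w = -1) (u : V) : V →ₗ[K] K where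
  toFun := B w u
  map_add' := hB.add_right w hw u
  map_smul' a v := hB.smul_right w hw a u v

/-- The `ι`-semilinear functional `B w · v`. -/
def leftSemilinear (hB : IsHermRep K ι π ρ B) {w : Ghat} (hw : π w = -1) (v : V) :
    V →ₛₗ[ι] K where
  toFun u := B w u v
  map_add' u u' := hB.add_left w hw u u' v
  map_smul' a u := hB.smul_left w hw a u v

theorem apply_map_right (hB : IsHermRep K ι π ρ B) {w : Ghat} (hw : π w = -1) (g : π.ker)
    (u v : V) : B w u (ρ g v) = B w (ρ (conjKer π w⁻¹ g)⁻¹ u) v := by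
  have hg : conjKer π w (conjKer π w⁻¹ g) = g := by
    ext
    simp [conjKer, mul_assoc]
  have h := hB.invariant w hw (conjKer π w⁻¹ g) (ρ (conjKer π w⁻¹ g)⁻¹ u) v
  rwa [hg, Representation.self_inv_apply] at h

theorem map_mem_perp (hB : IsHermRep K ι π ρ B) {W : Submodule K V}
    (hW : ∀ (g : π.ker), ∀ v ∈ W, ρ g v ∈ W) {w : Ghat} (hw : π w = -1) (g : π.ker)
    {v : V} (hv : v ∈ perp B W w) : ρ g v ∈ perp B W w := fun u hu => by
  rw [hB.apply_map_right hw]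
  exact hv _ (hW _ u hu)

theorem perp_subset_perp (hB : IsHermRep K ι π ρ B) {W : Submodule K V}
    (hW : ∀ (g : π.ker), ∀ v ∈ W, ρ g v ∈ W) {w₁ w₂ : Ghat} (h₁ : π w₁ = -1)
    (h₂ : π w₂ = -1) : perp B W w₁ ⊆ perp B W w₂ := fun v hv u hu => by
  rw [hB.compat w₂ w₁ h₂ h₁]
  exact hB.map_mem_perp hW h₁ _ hv u hu

theorem perp_eq_perp (hB : IsHermRep K ι π ρ B) {W : Submodule K V}
    (hW : ∀ (g : π.ker), ∀ v ∈ W, ρ g v ∈ W) {w₁ w₂ : Ghat} (h₁ : π w₁ = -1)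
    (h₂ : π w₂ = -1) : perp B W w₁ = perp B W w₂ :=
  (hB.perp_subset_perp hW h₁ h₂).antisymm (hB.perp_subset_perp hW h₂ h₁)

theorem mem_perp_of_basis (hB : IsHermRep K ι π ρ B) {W : Submodule K V} {w : Ghat}
    (hw : π w = -1) {n : Type*} (b : Module.Basis n K W) {v : V}
    (h : ∀ i, B w (b i) v = 0) : v ∈ perp B W w := by
  have h0 : (hB.leftSemilinear hw v).comp W.subtype = 0 := b.ext h
  exact fun u hu => LinearMap.congr_fun h0 ⟨u, hu⟩

theorem exists_add_mem_perp [FiniteDimensional K V] (hB : IsHermRep K ι π ρ B)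
    {W : Submodule K V} {w : Ghat} (hw : π w = -1)
    (hW : ∀ v ∈ W, (∀ u ∈ W, B w u v = 0) → v = 0) (v : V) :
    ∃ x ∈ W, ∃ y ∈ perp B W w, v = x + y := by
  let b := Module.finBasis K W
  let T : V →ₗ[K] Fin (Module.finrank K W) → K :=
    LinearMap.pi fun i => hB.rightLinear hw (b i)
  have hinj : Function.Injective (T ∘ₗ W.subtype) := by
    rw [injective_iff_map_eq_zero]
    intro x hx
    exact Subtype.ext (hW x x.2 (hB.mem_perp_of_basis hw b fun i => congrFun hx i))
  have hsurj : Function.Surjective (T ∘ₗ W.subtype) :=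
    (LinearMap.injective_iff_surjective_of_finrank_eq_finrank (by simp)).1 hinj
  obtain ⟨x, hx⟩ := hsurj (T v)
  have hT : T (v - x) = 0 := by
    rw [map_sub, sub_eq_zero]
    exact hx.symm
  exact ⟨x, x.2, v - x, hB.mem_perp_of_basis hw b fun i => congrFun hT i,
    (add_sub_cancel _ _).symm⟩

end IsHermRep

/-- Maschke's theorem for hermitian `K`-representations: the right orthogonal complement of a
subrepresentation `W` is independent of the choice of odd element, is `G`-invariant, is itself a
subrepresentation, and gives an internal direct sum decomposition `V = W ⊕ W^⊥`. -/
theorem maschke_orthogonal_complement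
    {K : Type} [Field K] (ι : K →+* K) (hι : ∀ a : K, ι (ι a) = a)
    {Ghat : Type} [Group Ghat] [Finite Ghat] (π : Ghat →* ℤˣ)
    (hπ : Function.Surjective π)
    {V : Type} [AddCommGroup V] [Module K V] [FiniteDimensional K V]
    (ρ : Representation K π.ker V) (B : Ghat → V → V → K)
    (hB : IsHermRep K ι π ρ B)
    (W : Submodule K V) (hW : IsSubrep K π ρ B W)
    (w₀ : Ghat) (hw₀ : π w₀ = -1) :
    (∀ w, π w = -1 → perp B W w = perp B W w₀) ∧
    (∀ (g : π.ker), ∀ v ∈ perp B W w₀, ρ g v ∈ perp B W w₀) ∧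
    (∀ w, π w = -1 →
      (∀ u ∈ perp B W w₀, (∀ v ∈ perp B W w₀, B w u v = 0) → u = 0) ∧
      (∀ v ∈ perp B W w₀, (∀ u ∈ perp B W w₀, B w u v = 0) → v = 0)) ∧
    (∀ v : V, ∃ x ∈ W, ∃ y ∈ perp B W w₀, v = x + y) ∧
    (∀ v ∈ W, v ∈ perp B W w₀ → v = 0) := by
  have hWG := hW.1
  have hadd := hB.exists_add_mem_perp hw₀ (hW.2 w₀ hw₀).2
  refine ⟨fun w hw => hB.perp_eq_perp hWG hw hw₀, fun g v => hB.map_mem_perp hWG hw₀ g,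
    fun w hw => ?_, hadd, (hW.2 w₀ hw₀).2⟩
  have hperp := hB.perp_eq_perp hWG hw hw₀
  refine ⟨fun u hu h => hB.nondeg_left w hw u fun v => ?_,
    fun v hv h => hB.nondeg_right w hw v fun u => ?_⟩
  · obtain ⟨x, hx, y, hy, rfl⟩ := hadd v
    have hux : B w u x = 0 := by
      rw [← hι (B w u x), ← hB.hermitian w hw]
      rw [← hperp] at hu
      rw [hB.map_mem_perp hWG hw _ hu x hx, map_zero]
    rw [hB.add_right w hw, hux, h y hy, add_zero]
  · obtain ⟨x, hx, y, hy, rfl⟩ := hadd u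
    rw [← hperp] at hv
    rw [hB.add_left w hw, hv x hx, h y hy, add_zero]
end

section
/- Let K be a field with an involutive automorphism ι (possibly the identity) and let (Ĝ, π) be a C₂-graded finite group. Every hermitian K-representation (V, (B_w)) of (Ĝ, π) admits finitely many irreducible subrepresentations W₁, …, W_m that are pairwise orthogonal with respect to every form B_w (i.e. B_w(u, v) = 0 for u ∈ W_i, v ∈ W_j, i ≠ j) and satisfy V = W₁ ⊕ ⋯ ⊕ W_m as an internal direct sum. -/
open scoped ComplexConjugate

namespace IsHermRep

variable {K : Type} [Field K] {ι : K →+* K} {Ghat : Type} [Group Ghat] {π : Ghat →* ℤˣ}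
  {V : Type} [AddCommGroup V] [Module K V]
  {ρ : Representation K π.ker V} {B : Ghat → V → V → K}

/-- The form `B w` as a linear map in its second argument. -/
def formRight (hB : IsHermRep K ι π ρ B) {w : Ghat} (hw : π w = -1) (u : V) : V →ₗ[K] K where
  toFun := B w u
  map_add' := hB.add_right w hw u
  map_smul' a v := hB.smul_right w hw a u v

/-- The common right orthogonal complement of `U` with respect to all forms `B w`. -/
def orthogonal (hB : IsHermRep K ι π ρ B) (U : Submodule K V) : Submodule K V where
  carrier := {v | ∀ w, π w = -1 → ∀ u ∈ U, B w u v = 0}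
  zero_mem' w hw u _ := (hB.formRight hw u).map_zero
  add_mem' {v v'} hv hv' w hw u hu := by
    rw [hB.add_right w hw, hv w hw u hu, hv' w hw u hu, add_zero]
  smul_mem' a v hv w hw u hu := by
    rw [hB.smul_right w hw, hv w hw u hu, mul_zero]

lemma rho_mem_orthogonal (hB : IsHermRep K ι π ρ B) {U : Submodule K V}
    (hU : ∀ g : π.ker, ∀ v ∈ U, ρ g v ∈ U) (g : π.ker) {v : V} (hv : v ∈ hB.orthogonal U) :
    ρ g v ∈ hB.orthogonal U := by
  intro w hw u hu
  let h : π.ker := conjKer π w⁻¹ g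
  have hg : conjKer π w h = g := by
    ext
    simp [h, conjKer, mul_assoc]
  have hinv := hB.invariant w hw h (ρ h⁻¹ u) v
  rw [hg, ← Module.End.mul_apply, ← map_mul, mul_inv_cancel, map_one,
    Module.End.one_apply] at hinv
  rw [hinv]
  exact hv w hw _ (hU _ u hu)

/-- Orthogonality to an invariant subspace is symmetric. -/
lemma form_eq_zero_of_mem_orthogonal (hB : IsHermRep K ι π ρ B) {U : Submodule K V}
    (hU : ∀ g : π.ker, ∀ v ∈ U, ρ g v ∈ U) {w : Ghat} (hw : π w = -1) {u v : V}
    (hu : u ∈ U) (hv : v ∈ hB.orthogonal U) : B w v u = 0 := by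
  apply ι.injective
  rw [← hB.hermitian w hw, map_zero]
  exact hB.rho_mem_orthogonal hU _ hv w hw u hu

lemma mem_orthogonal_of_forall (hB : IsHermRep K ι π ρ B) {U : Submodule K V}
    (hU : ∀ g : π.ker, ∀ v ∈ U, ρ g v ∈ U) {w : Ghat} (hw : π w = -1) {v : V}
    (hv : ∀ u ∈ U, B w u v = 0) : v ∈ hB.orthogonal U := by
  intro w' hw' u hu
  -- move the ratio of `w'` and `w` to the first argument by invariance
  let r := ratioKer π w w' hw hw'
  let h : π.ker := conjKer π w⁻¹ r
  have hr : conjKer π w h = r := by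
    ext
    simp [h, conjKer, mul_assoc]
  have hinv := hB.invariant w hw h (ρ h⁻¹ u) v
  rw [hr, ← Module.End.mul_apply, ← map_mul, mul_inv_cancel, map_one,
    Module.End.one_apply] at hinv
  rw [hB.compat w' w hw' hw]
  exact hinv.trans (hv _ (hU _ u hu))

lemma exists_mem_sub_mem_orthogonal [FiniteDimensional K V] (hB : IsHermRep K ι π ρ B)
    {U : Submodule K V} (hU : IsSubrep K π ρ B U) {w : Ghat} (hw : π w = -1) (v : V) :
    ∃ u ∈ U, v - u ∈ hB.orthogonal U := by
  let b := Module.finBasis K U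
  let f : V →ₗ[K] (Fin (Module.finrank K U) → K) :=
    LinearMap.pi fun i => hB.formRight hw (b i : V)
  have key : ∀ x : V, f x = 0 → ∀ u ∈ U, B w u x = 0 := by
    intro x hx u hu
    have hspan : (⟨u, hu⟩ : U) ∈ Submodule.span K (Set.range b) := by
      rw [b.span_eq]; trivial
    have hzero : B w 0 x = 0 := by
      simpa using hB.smul_left w hw 0 0 x
    refine Submodule.span_induction (p := fun (y : U) _ => B w (y : V) x = 0) ?_ hzero ?_ ?_ hspan
    · rintro _ ⟨i, rfl⟩
      exact congrFun hx i
    · intro y z _ _ hy hz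
      rw [Submodule.coe_add, hB.add_left w hw, hy, hz, add_zero]
    · intro a y _ hy
      rw [Submodule.coe_smul, hB.smul_left w hw, hy, mul_zero]
  have hinj : Function.Injective (f ∘ₗ U.subtype) := by
    rw [injective_iff_map_eq_zero]
    intro x hx
    exact Subtype.ext ((hU.2 w hw).2 x x.2 (key x hx))
  obtain ⟨u, hu⟩ := (LinearMap.injective_iff_surjective_of_finrank_eq_finrank
    (by simp)).1 hinj (f v)
  refine ⟨u, u.2, hB.mem_orthogonal_of_forall hU.1 hw (key _ ?_)⟩
  rw [map_sub, sub_eq_zero]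
  exact hu.symm

lemma disjoint_orthogonal (hB : IsHermRep K ι π ρ B) {U : Submodule K V}
    (hU : IsSubrep K π ρ B U) {w : Ghat} (hw : π w = -1) : Disjoint U (hB.orthogonal U) :=
  Submodule.disjoint_def.2 fun x hx hx' => (hU.2 w hw).2 x hx (hx' w hw)

lemma sup_orthogonal_inf [FiniteDimensional K V] (hB : IsHermRep K ι π ρ B)
    {U W : Submodule K V} (hU : IsSubrep K π ρ B U) (hUW : U ≤ W)
    {w : Ghat} (hw : π w = -1) : U ⊔ hB.orthogonal U ⊓ W = W := by
  refine le_antisymm (sup_le hUW inf_le_right) fun v hv => ?_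
  obtain ⟨u, hu, hvu⟩ := hB.exists_mem_sub_mem_orthogonal hU hw v
  exact Submodule.mem_sup.2 ⟨u, hu, v - u, ⟨hvu, W.sub_mem hv (hUW hu)⟩, add_sub_cancel u v⟩

/-- The orthogonal complement of a subrepresentation in a larger one is a subrepresentation. -/
lemma isSubrep_orthogonal_inf [FiniteDimensional K V] (hB : IsHermRep K ι π ρ B)
    {U W : Submodule K V} (hU : IsSubrep K π ρ B U) (hW : IsSubrep K π ρ B W) (hUW : U ≤ W) :
    IsSubrep K π ρ B (hB.orthogonal U ⊓ W) := by
  refine ⟨fun g v hv => ⟨hB.rho_mem_orthogonal hU.1 g hv.1, hW.1 g v hv.2⟩, fun w hw => ?_⟩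
  have hdecomp : ∀ x ∈ W, ∃ y ∈ U, ∃ z ∈ hB.orthogonal U ⊓ W, y + z = x := fun x hx =>
    Submodule.mem_sup.1 ((hB.sup_orthogonal_inf hU hUW hw).symm ▸ hx)
  constructor
  · intro u hu h
    refine (hW.2 w hw).1 u hu.2 fun x hx => ?_
    obtain ⟨y, hy, z, hz, rfl⟩ := hdecomp x hx
    rw [hB.add_right w hw, hB.form_eq_zero_of_mem_orthogonal hU.1 hw hy hu.1, h z hz, add_zero]
  · intro v hv h
    refine (hW.2 w hw).2 v hv.2 fun x hx => ?_
    obtain ⟨y, hy, z, hz, rfl⟩ := hdecomp x hx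
    rw [hB.add_left w hw, hv.1 w hw y hy, h z hz, add_zero]

lemma isSubrep_top (hB : IsHermRep K ι π ρ B) : IsSubrep K π ρ B ⊤ :=
  ⟨fun _ _ _ => trivial, fun w hw =>
    ⟨fun u _ h => hB.nondeg_left w hw u fun v => h v trivial,
      fun v _ h => hB.nondeg_right w hw v fun u => h u trivial⟩⟩

/-- Every subrepresentation is the span of a finite orthogonal family of irreducible ones. -/
lemma exists_orthogonal_irreducible_family [FiniteDimensional K V] (hB : IsHermRep K ι π ρ B)
    {w₀ : Ghat} (hw₀ : π w₀ = -1) (W : Submodule K V) (hW : IsSubrep K π ρ B W) :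
    ∃ (I : Type) (_ : Finite I) (F : I → Submodule K V),
      (∀ i, IsIrredSubrep K π ρ B (F i)) ∧
      (∀ i j, i ≠ j → ∀ w, π w = -1 → ∀ u ∈ F i, ∀ v ∈ F j, B w u v = 0) ∧
      ⨆ i, F i = W := by
  induction W using WellFoundedLT.induction with
  | ind W ih =>
  by_cases hbot : W = ⊥
  · exact ⟨Empty, inferInstance, Empty.elim, fun i => i.elim, fun i => i.elim, by simp [hbot]⟩
  by_cases hirr : IsIrredSubrep K π ρ B W
  · exact ⟨Unit, inferInstance, fun _ => W, fun _ => hirr,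
      fun i j hij => (hij (Subsingleton.elim i j)).elim, by simp⟩
  obtain ⟨U, hUW, hU, hU0, hU1⟩ :
      ∃ U ≤ W, IsSubrep K π ρ B U ∧ U ≠ ⊥ ∧ U ≠ W := by
    by_contra! h
    exact hirr ⟨hW, hbot, fun U hUW hU => or_iff_not_imp_left.2 (h U hUW hU)⟩
  have hlt : hB.orthogonal U ⊓ W < W := by
    refine lt_of_le_of_ne inf_le_right fun h => hU0 ?_
    exact (hB.disjoint_orthogonal hU hw₀).eq_bot_of_le (hUW.trans (inf_eq_right.1 h))
  obtain ⟨I, _, F, hFirr, hForth, hFsup⟩ := ih U (lt_of_le_of_ne hUW hU1) hU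
  obtain ⟨J, _, E, hEirr, hEorth, hEsup⟩ := ih _ hlt (hB.isSubrep_orthogonal_inf hU hW hUW)
  have hF : ∀ i, F i ≤ U := fun i => hFsup ▸ le_iSup F i
  have hE : ∀ j, E j ≤ hB.orthogonal U := fun j =>
    ((le_iSup E j).trans hEsup.le).trans inf_le_left
  refine ⟨I ⊕ J, inferInstance, Sum.elim F E, ?_, ?_, ?_⟩
  · rintro (i | j)
    exacts [hFirr i, hEirr j]
  · rintro (i | i) (j | j) hij w hw u hu v hv
    · exact hForth i j (fun h => hij (h ▸ rfl)) w hw u hu v hv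
    · exact hE j hv w hw u (hF i hu)
    · exact hB.form_eq_zero_of_mem_orthogonal hU.1 hw (hF j hv) (hE i hu)
    · exact hEorth i j (fun h => hij (h ▸ rfl)) w hw u hu v hv
  · rw [iSup_sum]
    simp only [Sum.elim_inl, Sum.elim_inr]
    rw [hFsup, hEsup, hB.sup_orthogonal_inf hU hUW hw₀]

end IsHermRep

/-- Every hermitian `K`-representation decomposes as a finite orthogonal internal direct sum of
irreducible subrepresentations. -/
theorem herm_rep_decomposition
    {K : Type} [Field K] (ι : K →+* K) (hι : ∀ a : K, ι (ι a) = a)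
    {Ghat : Type} [Group Ghat] [Finite Ghat] (π : Ghat →* ℤˣ)
    (hπ : Function.Surjective π)
    {V : Type} [AddCommGroup V] [Module K V] [FiniteDimensional K V]
    (ρ : Representation K π.ker V) (B : Ghat → V → V → K)
    (hB : IsHermRep K ι π ρ B) :
    ∃ (m : ℕ) (W : Fin m → Submodule K V),
      (∀ i, IsIrredSubrep K π ρ B (W i)) ∧
      (∀ i j, i ≠ j → ∀ w, π w = -1 → ∀ u ∈ W i, ∀ v ∈ W j, B w u v = 0) ∧
      (∀ v : V, ∃ c : Fin m → V, (∀ i, c i ∈ W i) ∧ v = ∑ i, c i) ∧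
      (∀ c : Fin m → V, (∀ i, c i ∈ W i) → ∑ i, c i = 0 → ∀ i, c i = 0) := by
  obtain ⟨w₀, hw₀⟩ := hπ (-1)
  obtain ⟨I, _, F, hirr, horth, hsup⟩ :=
    hB.exists_orthogonal_irreducible_family hw₀ ⊤ hB.isSubrep_top
  let e := Finite.equivFin I
  have horth' : ∀ i j, i ≠ j → ∀ w, π w = -1 →
      ∀ u ∈ F (e.symm i), ∀ v ∈ F (e.symm j), B w u v = 0 :=
    fun i j hij => horth _ _ (e.symm.injective.ne hij)
  refine ⟨Nat.card I, fun i => F (e.symm i), fun i => hirr _, horth', fun v => ?_, ?_⟩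
  · have hv : v ∈ ⨆ i, F (e.symm i) := by
      rw [e.symm.iSup_comp (g := F), hsup]
      trivial
    obtain ⟨c, hc, hsum⟩ := (Submodule.mem_iSup_iff_exists_finsupp _ _).1 hv
    exact ⟨c, hc, by rw [← hsum, Finsupp.sum_fintype _ _ fun _ => rfl]⟩
  · intro c hc hsum i
    refine ((hirr (e.symm i)).1.2 w₀ hw₀).2 _ (hc i) fun u hu => ?_
    have h := congrArg (hB.formRight hw₀ u) hsum
    rw [map_sum, map_zero, Finset.sum_eq_single i
      (fun j _ hji => show hB.formRight hw₀ u (c j) = 0 from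
        horth' i j hji.symm w₀ hw₀ u hu _ (hc j))
      (fun hi => (hi (Finset.mem_univ i)).elim)] at h
    exact h
end

section
/- Let (Ĝ, π) be a C₂-graded finite group and let (V, (B_w)) be an irreducible L-representation of (Ĝ, π). Suppose some simple ℂG-submodule W of V satisfies W ∩ W^⊥ = 0, where W^⊥ := {v ∈ V : B_w(u, v) = 0 for all u ∈ W} for some (equivalently, every) odd w. Then W = V (so the underlying ℂG-module of V is simple), and the group Aut_L(V) of L-automorphisms of V equals {id_V, −id_V}. -/
open scoped ComplexConjugate

/-- If no nonzero vector of an invariant subspace `W` is right orthogonal to `W` for one odd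
element, then `W` is a subrepresentation. -/
theorem IsHermRep.isSubrep_of_perp_eq_zero {K Ghat V : Type} [Field K] {ι : K →+* K} [Group Ghat]
    {π : Ghat →* ℤˣ} [AddCommGroup V] [Module K V] {ρ : Representation K π.ker V}
    {B : Ghat → V → V → K} (hB : IsHermRep K ι π ρ B) {W : Submodule K V}
    (hW : ∀ (g : π.ker), ∀ v ∈ W, ρ g v ∈ W) {w₀ : Ghat} (hw₀ : π w₀ = -1)
    (hmeet : ∀ v ∈ W, v ∈ perp B W w₀ → v = 0) : IsSubrep K π ρ B W := by
  have right : ∀ w, π w = -1 → ∀ v ∈ W, (∀ u ∈ W, B w u v = 0) → v = 0 := by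
    intro w hw v hv h
    have h0 : ρ (ratioKer π w₀ w hw₀ hw) v = 0 :=
      hmeet _ (hW _ v hv) fun u hu => by rw [← hB.compat w w₀ hw hw₀]; exact h u hu
    rw [← ρ.inv_self_apply (ratioKer π w₀ w hw₀ hw) v, h0, map_zero]
  refine ⟨hW, fun w hw => ⟨fun u hu h => right w hw u hu fun v hv => ?_, right w hw⟩⟩
  have := hB.hermitian w hw u v
  rw [h _ (hW _ v hv)] at this
  exact (map_eq_zero ι).mp this.symm

/-- **Schur's lemma** for endomorphisms: over an algebraically closed field, an equivariant
endomorphism of a simple finite-dimensional representation is a scalar. -/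
theorem IsSimpleGSub.exists_eq_smul_id {K Ghat V : Type} [Field K] [IsAlgClosed K] [Group Ghat]
    {π : Ghat →* ℤˣ} [AddCommGroup V] [Module K V] [FiniteDimensional K V] [Nontrivial V]
    {ρ : Representation K π.ker V} (hV : IsSimpleGSub K π ρ ⊤) {f : V →ₗ[K] V}
    (hf : ∀ (g : π.ker) (v : V), f (ρ g v) = ρ g (f v)) : ∃ c : K, f = c • LinearMap.id := by
  obtain ⟨c, hc⟩ := Module.End.exists_eigenvalue f
  refine ⟨c, LinearMap.ext fun v => ?_⟩
  have hinv : ∀ (g : π.ker), ∀ v ∈ Module.End.eigenspace f c,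
      ρ g v ∈ Module.End.eigenspace f c := by
    intro g v hv
    rw [Module.End.mem_eigenspace_iff] at hv ⊢
    rw [hf, hv, map_smul]
  have htop := (hV.2.2 _ le_top hinv).resolve_left hc
  exact Module.End.mem_eigenspace_iff.mp (htop ▸ Submodule.mem_top)

/-- Case A of the structure theorem for irreducible `L`-representations: if some simple
`ℂG`-submodule `W` satisfies `W ∩ W^⊥ = 0`, then `W = V` (the underlying `ℂG`-module is simple)
and the `L`-automorphisms of `V` are exactly `± id`. -/
theorem irred_L_rep_caseA
    {Ghat : Type} [Group Ghat] [Finite Ghat] (π : Ghat →* ℤˣ)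
    (hπ : Function.Surjective π)
    {V : Type} [AddCommGroup V] [Module ℂ V] [FiniteDimensional ℂ V]
    (ρ : Representation ℂ π.ker V) (B : Ghat → V → V → ℂ)
    (hB : IsLRep π ρ B) (hirr : IsIrredRep ℂ π ρ B)
    (W : Submodule ℂ V) (hW : IsSimpleGSub ℂ π ρ W)
    (w₀ : Ghat) (hw₀ : π w₀ = -1)
    (hmeet : ∀ v ∈ W, v ∈ perp B W w₀ → v = 0) :
    W = ⊤ ∧ ∀ f : V →ₗ[ℂ] V,
      (Function.Bijective f ∧ (∀ (g : π.ker) (v : V), f (ρ g v) = ρ g (f v)) ∧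
        (∀ w, π w = -1 → ∀ u v : V, B w (f u) (f v) = B w u v)) ↔
      (f = LinearMap.id ∨ f = -LinearMap.id) := by
  obtain ⟨⟨v₀, hv₀⟩, hirr⟩ := hirr
  have hWtop : W = ⊤ :=
    (hirr W (hB.isSubrep_of_perp_eq_zero hW.1 hw₀ hmeet)).resolve_left hW.2.1
  subst hWtop
  have : Nontrivial V := ⟨v₀, 0, hv₀⟩
  refine ⟨rfl, fun f => ⟨?_, ?_⟩⟩
  · rintro ⟨-, hf, hform⟩
    obtain ⟨c, rfl⟩ := hW.exists_eq_smul_id hf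
    have hne : ∃ v, B w₀ v₀ v ≠ 0 := by
      by_contra! h
      exact hv₀ (hB.nondeg_left w₀ hw₀ v₀ h)
    obtain ⟨v, hv⟩ := hne
    have h := hform w₀ hw₀ v₀ v
    simp only [LinearMap.smul_apply, LinearMap.id_apply, hB.smul_left w₀ hw₀,
      hB.smul_right w₀ hw₀, RingHom.id_apply] at h
    have hc : c * c = 1 := mul_right_cancel₀ hv (by rw [mul_assoc, h, one_mul])
    rcases mul_self_eq_one_iff.mp hc with rfl | rfl
    · exact Or.inl (one_smul _ _)
    · exact Or.inr (by rw [neg_smul, one_smul])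
  · rintro (rfl | rfl)
    · exact ⟨Function.bijective_id, fun _ _ => rfl, fun _ _ _ _ => rfl⟩
    · refine ⟨(Equiv.neg V).bijective, fun g v => by simp, fun w hw u v => ?_⟩
      simp only [LinearMap.neg_apply, LinearMap.id_apply]
      rw [← neg_one_smul ℂ u, ← neg_one_smul ℂ v, hB.smul_left w hw, hB.smul_right w hw]
      simp
end

section
/- Let (Ĝ, π) be a C₂-graded finite group and let (V, (B_w)) be an irreducible L-representation of (Ĝ, π) in which every simple ℂG-submodule W satisfies W ⊆ W^⊥, where W^⊥ := {v ∈ V : B_w(u, v) = 0 for all u ∈ W} for some (equivalently, every) odd w. Then for every simple ℂG-submodule W of V there is a simple ℂG-submodule W' of V with V = W ⊕ W' as ℂG-modules, W^⊥ = W, and dim W = dim W' = (dim V)/2. -/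
open scoped ComplexConjugate

namespace IsHermRep

variable {Ghat : Type} [Group Ghat] {π : Ghat →* ℤˣ} {V : Type} [AddCommGroup V] [Module ℂ V]
  {ρ : Representation ℂ π.ker V} {B : Ghat → V → V → ℂ}

/-- The form `B w` of an `L`-representation, bundled as a bilinear map. -/
def bilin (hB : IsLRep π ρ B) {w : Ghat} (hw : π w = -1) : V →ₗ[ℂ] V →ₗ[ℂ] ℂ :=
  LinearMap.mk₂ ℂ (B w) (hB.add_left w hw) (hB.smul_left w hw) (hB.add_right w hw)
    (hB.smul_right w hw)

@[simp]
theorem bilin_apply (hB : IsLRep π ρ B) {w : Ghat} (hw : π w = -1) (u v : V) :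
    hB.bilin hw u v = B w u v :=
  rfl

/-- Invariance, with the group element moved from the left argument to the right one. -/
theorem apply_left (hB : IsLRep π ρ B) {w : Ghat} (hw : π w = -1) (g : π.ker) (u v : V) :
    B w (ρ g u) v = B w u (ρ (conjKer π w g)⁻¹ v) := by
  rw [← hB.invariant w hw g u, Representation.self_inv_apply]

/-- Invariance, with the group element moved from the right argument to the left one. -/
theorem apply_right (hB : IsLRep π ρ B) {w : Ghat} (hw : π w = -1) (g : π.ker) (u v : V) :
    B w u (ρ g v) = B w (ρ (conjKer π w⁻¹ g)⁻¹ u) v := by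
  rw [hB.apply_left hw]
  congr 3
  ext
  simp [conjKer, mul_assoc]

/-- The right orthogonal complement of an invariant subspace is also a left one. -/
theorem apply_eq_zero_comm (hB : IsLRep π ρ B) {w : Ghat} (hw : π w = -1) {W : Submodule ℂ V}
    (hW : ∀ (g : π.ker), ∀ v ∈ W, ρ g v ∈ W) (v : V) :
    (∀ u ∈ W, B w u v = 0) ↔ ∀ u ∈ W, B w v u = 0 := by
  have key (u : V) : B w u v = B w v (ρ (sqKer π w) u) := (hB.hermitian w hw v u).symm
  refine ⟨fun h u hu => ?_, fun h u hu => ?_⟩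
  · rw [← Representation.self_inv_apply ρ (sqKer π w) u, ← key]
    exact h _ (hW _ _ hu)
  · rw [key]
    exact h _ (hW _ _ hu)

theorem apply_mem_orthogonalBilin (hB : IsLRep π ρ B) {w : Ghat} (hw : π w = -1)
    {W : Submodule ℂ V} (hW : ∀ (g : π.ker), ∀ v ∈ W, ρ g v ∈ W) (g : π.ker) {v : V}
    (hv : v ∈ W.orthogonalBilin (hB.bilin hw)) : ρ g v ∈ W.orthogonalBilin (hB.bilin hw) := by
  intro u hu
  rw [bilin_apply, hB.apply_right hw]
  exact hv _ (hW _ _ hu)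

/-- For an invariant subspace, nondegeneracy with respect to one odd element suffices. -/
theorem isSubrep_of_nondegenerate (hB : IsLRep π ρ B) {w₀ : Ghat} (hw₀ : π w₀ = -1)
    {W : Submodule ℂ V} (hW : ∀ (g : π.ker), ∀ v ∈ W, ρ g v ∈ W)
    (h : ∀ v ∈ W, (∀ u ∈ W, B w₀ u v = 0) → v = 0) : IsSubrep ℂ π ρ B W := by
  have right {w : Ghat} (hw : π w = -1) (v : V) (hv : v ∈ W) (hv' : ∀ u ∈ W, B w u v = 0) :
      v = 0 := by
    have := h _ (hW (ratioKer π w₀ w hw₀ hw) v hv) fun u hu => by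
      rw [← hB.compat w w₀ hw hw₀, hv' u hu]
    rw [← Representation.inv_self_apply ρ (ratioKer π w₀ w hw₀ hw) v, this, map_zero]
  exact ⟨hW, fun w hw => ⟨fun u hu hu' => right hw u hu ((hB.apply_eq_zero_comm hw hW u).2 hu'),
    right hw⟩⟩

end IsHermRep

/-- **Maschke's theorem** for invariant subspaces. -/
theorem Representation.exists_isCompl_invariant {k G V : Type*} [Field k] [Group G] [Finite G]
    [NeZero (Nat.card G : k)] [AddCommGroup V] [Module k V] (ρ : Representation k G V)
    {W : Submodule k V} (hW : ∀ g, ∀ v ∈ W, ρ g v ∈ W) :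
    ∃ W' : Submodule k V, (∀ g, ∀ v ∈ W', ρ g v ∈ W') ∧ IsCompl W W' := by
  have : ρ.IsSemisimpleRepresentation := inferInstance
  have : ComplementedLattice (Subrepresentation ρ) := this
  obtain ⟨σ, hσ⟩ := exists_isCompl (⟨W, fun g v => hW g v⟩ : Subrepresentation ρ)
  refine ⟨σ.toSubmodule, fun g _ => (σ.apply_mem_toSubmodule g ·), ?_⟩
  rw [isCompl_iff, disjoint_iff, codisjoint_iff] at hσ ⊢
  exact ⟨congrArg Subrepresentation.toSubmodule hσ.1, congrArg Subrepresentation.toSubmodule hσ.2⟩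

/-- If no nonzero vector of `W` is orthogonal to `U`, then `dim W ≤ dim U`. -/
theorem LinearMap.finrank_le_of_separatingLeft_on {k V : Type*} [Field k] [AddCommGroup V]
    [Module k V] [FiniteDimensional k V] (b : V →ₗ[k] V →ₗ[k] k) {W U : Submodule k V}
    (h : ∀ u ∈ W, (∀ v ∈ U, b u v = 0) → u = 0) : Module.finrank k W ≤ Module.finrank k U := by
  rw [← Subspace.dual_finrank_eq (K := k) (V := U)]
  refine LinearMap.finrank_le_finrank_of_injective (f := b.domRestrict₁₂ W U) ?_
  rw [injective_iff_map_eq_zero]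
  exact fun u hu => Subtype.ext (h u u.2 fun v hv => LinearMap.congr_fun hu ⟨v, hv⟩)

/-- Case B of the structure theorem for irreducible `L`-representations: if every simple
`ℂG`-submodule `W` is contained in its own orthogonal complement, then for every simple
`ℂG`-submodule `W` there is a simple complement `W'` with `V = W ⊕ W'`, `W^⊥ = W` and
`dim W = dim W' = (dim V)/2`. -/
theorem irred_L_rep_caseB
    {Ghat : Type} [Group Ghat] [Finite Ghat] (π : Ghat →* ℤˣ)
    (hπ : Function.Surjective π)
    {V : Type} [AddCommGroup V] [Module ℂ V] [FiniteDimensional ℂ V]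
    (ρ : Representation ℂ π.ker V) (B : Ghat → V → V → ℂ)
    (hB : IsLRep π ρ B) (hirr : IsIrredRep ℂ π ρ B)
    (w₀ : Ghat) (hw₀ : π w₀ = -1)
    (hall : ∀ W : Submodule ℂ V, IsSimpleGSub ℂ π ρ W → (W : Set V) ⊆ perp B W w₀) :
    ∀ W : Submodule ℂ V, IsSimpleGSub ℂ π ρ W →
      ∃ W' : Submodule ℂ V, IsSimpleGSub ℂ π ρ W' ∧ W ⊓ W' = ⊥ ∧ W ⊔ W' = ⊤ ∧
        perp B W w₀ = (W : Set V) ∧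
        Module.finrank ℂ ↥W = Module.finrank ℂ ↥W' ∧
        2 * Module.finrank ℂ ↥W = Module.finrank ℂ V := by
  intro W hW
  have perp_eq : perp B W w₀ = W.orthogonalBilin (hB.bilin hw₀) := rfl
  set P := W.orthogonalBilin (hB.bilin hw₀)
  have hWP : W ≤ P := hall W hW
  obtain ⟨W', hW', hc⟩ : ∃ W' : Submodule ℂ V, _ ∧ IsCompl P W' :=
    ρ.exists_isCompl_invariant fun g v => hB.apply_mem_orthogonalBilin hw₀ hW.1 g (v := v)
  have left : ∀ u ∈ W, (∀ v ∈ W', B w₀ u v = 0) → u = 0 := by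
    refine fun u hu h => hB.nondeg_left w₀ hw₀ u fun v => ?_
    obtain ⟨p, hp, c, hc, rfl⟩ := Submodule.mem_sup.1 (hc.sup_eq_top ▸ Submodule.mem_top (x := v))
    rw [hB.add_right w₀ hw₀, h c hc, add_zero]
    exact hp u hu
  have right : ∀ v ∈ W', (∀ u ∈ W, B w₀ u v = 0) → v = 0 := fun v hv h =>
    (Submodule.disjoint_def.1 hc.disjoint) v h hv
  have le₁ : Module.finrank ℂ W ≤ Module.finrank ℂ W' :=
    (hB.bilin hw₀).finrank_le_of_separatingLeft_on left
  have le₂ : Module.finrank ℂ W' ≤ Module.finrank ℂ W :=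
    (hB.bilin hw₀).flip.finrank_le_of_separatingLeft_on right
  have hsimple : IsSimpleGSub ℂ π ρ W' := by
    refine ⟨hW', fun h => hW.2.1 ?_, fun U hU hUinv => ?_⟩
    · rw [h, finrank_bot] at le₁
      exact Submodule.finrank_eq_zero.1 (Nat.le_zero.1 le₁)
    have hinv : ∀ g : π.ker, ∀ v ∈ W ⊓ U.orthogonalBilin (hB.bilin hw₀).flip,
        ρ g v ∈ W ⊓ U.orthogonalBilin (hB.bilin hw₀).flip := by
      refine fun g v hv => ⟨hW.1 g v hv.1, fun u hu => ?_⟩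
      rw [LinearMap.flip_apply, hB.bilin_apply, hB.apply_left hw₀]
      exact hv.2 _ (hUinv _ _ hu)
    rcases hW.2.2 _ inf_le_left hinv with h | h
    · right
      refine Submodule.eq_of_le_of_finrank_le hU (le₂.trans ?_)
      refine (hB.bilin hw₀).finrank_le_of_separatingLeft_on fun u hu hu' => ?_
      rw [← Submodule.mem_bot ℂ, ← h]
      exact ⟨hu, hu'⟩
    · left
      exact (Submodule.eq_bot_iff _).2 fun v hv =>
        right v (hU hv) fun u hu => (inf_eq_left.1 h hu) v hv
  have hsub : IsSubrep ℂ π ρ B (W ⊔ W') := by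
    have hinv : ∀ g : π.ker, ∀ v ∈ W ⊔ W', ρ g v ∈ W ⊔ W' := by
      intro g v hv
      obtain ⟨a, ha, c, hc, rfl⟩ := Submodule.mem_sup.1 hv
      rw [map_add]
      exact Submodule.add_mem_sup (hW.1 g a ha) (hW' g c hc)
    refine hB.isSubrep_of_nondegenerate hw₀ hinv fun v hv h => ?_
    obtain ⟨a, ha, c, hc, rfl⟩ := Submodule.mem_sup.1 hv
    have hc0 : c = 0 := right c hc fun u hu => by
      have := h u (Submodule.mem_sup_left hu)
      rwa [hB.add_right w₀ hw₀, show B w₀ u a = 0 from hWP ha u hu, zero_add] at this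
    rw [hc0, add_zero] at h ⊢
    exact left a ha ((hB.apply_eq_zero_comm hw₀ hW' a).1 fun u hu =>
      h u (Submodule.mem_sup_right hu))
  have htop : W ⊔ W' = ⊤ := (hirr.2 _ hsub).resolve_left fun h => hW.2.1 (sup_eq_bot_iff.1 h).1
  have hbot : W ⊓ W' = ⊥ := (hc.disjoint.mono_left hWP).eq_bot
  have hPW : P = W :=
    (eq_of_le_of_inf_le_of_sup_le hWP (hc.inf_eq_bot.le.trans bot_le) (htop ▸ le_top)).symm
  have hdim := Submodule.finrank_add_eq_of_isCompl ⟨disjoint_iff.2 hbot, codisjoint_iff.2 htop⟩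
  exact ⟨W', hsimple, hbot, htop, by rw [perp_eq, hPW], le₁.antisymm le₂, by omega⟩
end

section
/- Let (Ĝ, π) be a C₂-graded finite group and let (V, (B_w)) be an irreducible L-representation of (Ĝ, π) whose underlying ℂG-module decomposes as V = W ⊕ W' with W, W' simple ℂG-submodules, W^⊥ = W (with respect to any odd w), and W not isomorphic to W' as ℂG-modules. Then the group Aut_L(V) of L-automorphisms of V is isomorphic, as a group, to the multiplicative group ℂˣ of nonzero complex numbers. -/
open scoped ComplexConjugate

namespace IsSimpleGSub

variable {Ghat : Type} [Group Ghat] {K : Type} [Field K] {π : Ghat →* ℤˣ}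
  {V : Type} [AddCommGroup V] [Module K V] {ρ : Representation K π.ker V}
  {A A' : Submodule K V}

/-- Schur's lemma: an equivariant map between simple submodules vanishes or is bijective. -/
theorem eq_zero_or_bijective (hA : IsSimpleGSub K π ρ A) (hA' : IsSimpleGSub K π ρ A')
    (φ : V →ₗ[K] V) (hφ : ∀ v ∈ A, φ v ∈ A')
    (hequiv : ∀ (g : π.ker), ∀ v ∈ A, φ (ρ g v) = ρ g (φ v)) :
    (∀ v ∈ A, φ v = 0) ∨ (Set.InjOn φ A ∧ Submodule.map φ A = A') := by
  rcases hA.2.2 (A ⊓ LinearMap.ker φ) inf_le_left (fun g v hv =>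
      ⟨hA.1 g v hv.1, by
        have h0 : φ v = 0 := hv.2
        change φ (ρ g v) = 0
        rw [hequiv g v hv.1, h0, map_zero]⟩) with h | h
  · right
    have hinj : Set.InjOn φ A := by
      intro x hx y hy hxy
      have hmem : x - y ∈ A ⊓ LinearMap.ker φ :=
        ⟨A.sub_mem hx hy, by simp [LinearMap.mem_ker, hxy]⟩
      rw [h, Submodule.mem_bot] at hmem
      exact sub_eq_zero.mp hmem
    refine ⟨hinj, ?_⟩
    rcases hA'.2.2 (Submodule.map φ A) (Submodule.map_le_iff_le_comap.mpr hφ) (by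
      rintro g _ ⟨v, hv, rfl⟩
      exact ⟨ρ g v, hA.1 g v hv, hequiv g v hv⟩) with h' | h'
    · refine absurd ((Submodule.eq_bot_iff A).mpr fun x hx => ?_) hA.2.1
      have h0 : φ x = 0 :=
        (Submodule.eq_bot_iff _).mp h' _ (Submodule.mem_map_of_mem hx)
      exact hinj hx A.zero_mem (by rw [h0, map_zero])
    · exact h'
  · left
    intro v hv
    rw [← h] at hv
    exact hv.2

/-- An equivariant bijection between invariant subspaces has an equivariant inverse. -/
theorem exists_inverse (hA : IsSimpleGSub K π ρ A) (φ : V →ₗ[K] V)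
    (hinj : Set.InjOn φ A) (hmap : Submodule.map φ A = A')
    (hequiv : ∀ (g : π.ker), ∀ v ∈ A, φ (ρ g v) = ρ g (φ v)) :
    ∃ f : V →ₗ[K] V, Set.InjOn f A' ∧ Submodule.map f A' = A ∧
      ∀ (g : π.ker), ∀ u ∈ A', f (ρ g u) = ρ g (f u) := by
  subst hmap
  obtain ⟨r, hr⟩ := LinearMap.exists_leftInverse_of_injective (φ ∘ₗ A.subtype) (by
    rw [LinearMap.ker_eq_bot]
    intro x y hxy
    exact Subtype.ext (hinj x.2 y.2 hxy))
  have key : ∀ v ∈ A, ((A.subtype ∘ₗ r) (φ v)) = v := fun v hv =>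
    congrArg Subtype.val (LinearMap.congr_fun hr ⟨v, hv⟩)
  refine ⟨A.subtype ∘ₗ r, ?_, ?_, ?_⟩
  · rintro _ ⟨x, hx, rfl⟩ _ ⟨y, hy, rfl⟩ hxy
    rw [key x hx, key y hy] at hxy
    rw [hxy]
  · ext v
    constructor
    · rintro ⟨u, -, rfl⟩
      exact (r u).2
    · exact fun hv => ⟨φ v, Submodule.mem_map_of_mem hv, key v hv⟩
  · rintro g _ ⟨x, hx, rfl⟩
    rw [← hequiv g x hx, key _ (hA.1 g x hx), key x hx]

/-- Schur's lemma over an algebraically closed field: equivariant endomorphisms are scalars. -/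
theorem exists_scalar [IsAlgClosed K] [FiniteDimensional K V] (hA : IsSimpleGSub K π ρ A)
    (φ : V →ₗ[K] V) (hφ : ∀ v ∈ A, φ v ∈ A)
    (hequiv : ∀ (g : π.ker), ∀ v ∈ A, φ (ρ g v) = ρ g (φ v)) :
    ∃ c : K, ∀ v ∈ A, φ v = c • v := by
  have : Nontrivial A := A.nontrivial_iff_ne_bot.mpr hA.2.1
  obtain ⟨c, hc⟩ := Module.End.exists_eigenvalue (φ.restrict hφ)
  obtain ⟨x, hx⟩ := hc.exists_hasEigenvector
  have hx' : φ x = c • (x : V) := congrArg Subtype.val hx.apply_eq_smul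
  refine ⟨c, ?_⟩
  rcases hA.2.2 (A ⊓ LinearMap.ker (φ - c • LinearMap.id)) inf_le_left (fun g v hv =>
      ⟨hA.1 g v hv.1, by
        have h0 : φ v - c • v = 0 := hv.2
        change φ (ρ g v) - c • ρ g v = 0
        rw [hequiv g v hv.1, sub_eq_zero.mp h0, map_smul, sub_self]⟩) with h | h
  · have hmem : (x : V) ∈ A ⊓ LinearMap.ker (φ - c • LinearMap.id) :=
      ⟨x.2, by simp [LinearMap.mem_ker, hx']⟩
    rw [h, Submodule.mem_bot] at hmem
    exact absurd (Subtype.ext hmem) hx.2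
  · intro v hv
    rw [← h] at hv
    exact sub_eq_zero.mp hv.2

end IsSimpleGSub

/-- The projection along a decomposition into invariant subspaces is equivariant. -/
theorem projection_map_rep {K G V : Type} [Field K] [Group G] [AddCommGroup V] [Module K V]
    (ρ : Representation K G V) {A A' : Submodule K V} (h : IsCompl A A')
    (hA : ∀ g, ∀ v ∈ A, ρ g v ∈ A) (hA' : ∀ g, ∀ v ∈ A', ρ g v ∈ A') (g : G) (v : V) :
    A.projection A' h (ρ g v) = ρ g (A.projection A' h v) := by
  conv_lhs => rw [← Submodule.projection_add_projection_eq_self h v]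
  rw [map_add, map_add,
    Submodule.projection_apply_of_mem_left h (hA g _ (Submodule.projection_apply_mem h v)),
    (Submodule.projection_apply_eq_zero_iff h).mpr
      (hA' g _ (Submodule.projection_apply_mem h.symm v)), add_zero]

/-- The automorphism acting by `c` on `A` and by `c⁻¹` on the complement `A'`. -/
noncomputable def hyperbolicScaling {K V : Type} [Field K] [AddCommGroup V] [Module K V]
    {A A' : Submodule K V} (h : IsCompl A A') : Kˣ →* (V ≃ₗ[K] V) :=
  (LinearMap.GeneralLinearGroup.generalLinearEquiv K V).toMonoidHom.comp
    (MonoidHom.toHomUnits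
      { toFun := fun c => (c : K) • A.projection A' h + ((c⁻¹ : Kˣ) : K) • A'.projection A h.symm
        map_one' := by
          ext v
          simpa using Submodule.projection_add_projection_eq_self h v
        map_mul' := fun c d => by
          ext v
          have h1 := Submodule.projection_apply_mem h v
          have h2 := Submodule.projection_apply_mem h.symm v
          simp only [LinearMap.add_apply, LinearMap.smul_apply, Module.End.mul_apply, map_add,
            map_smul, Submodule.projection_apply_of_mem_left h h1,
            Submodule.projection_apply_of_mem_left h.symm h2,
            (Submodule.projection_apply_eq_zero_iff h).mpr h2,
            (Submodule.projection_apply_eq_zero_iff h.symm).mpr h1]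
          simp [mul_smul, smul_comm (c : K) (d : K)] })

theorem hyperbolicScaling_apply {K V : Type} [Field K] [AddCommGroup V] [Module K V]
    {A A' : Submodule K V} (h : IsCompl A A') (c : Kˣ) (v : V) :
    hyperbolicScaling h c v =
      (c : K) • A.projection A' h v + ((c⁻¹ : Kˣ) : K) • A'.projection A h.symm v :=
  rfl

namespace IsHermRep

variable {Ghat : Type} [Group Ghat] {K : Type} [Field K] {ι : K →+* K} {π : Ghat →* ℤˣ}
  {V : Type} [AddCommGroup V] [Module K V] {ρ : Representation K π.ker V}
  {B : Ghat → V → V → K} {A : Submodule K V} {w₀ : Ghat}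

/-- On an invariant subspace, left nondegeneracy of one form suffices. -/
theorem isSubrep_of_nondeg_left (hB : IsHermRep K ι π ρ B) (hw₀ : π w₀ = -1)
    (hA : ∀ (g : π.ker), ∀ v ∈ A, ρ g v ∈ A)
    (hnd : ∀ u ∈ A, (∀ v ∈ A, B w₀ u v = 0) → u = 0) : IsSubrep K π ρ B A := by
  have hleft : ∀ w, π w = -1 → ∀ u ∈ A, (∀ v ∈ A, B w u v = 0) → u = 0 :=
    fun w hw u hu h => hnd u hu fun v hv => by
      rw [hB.compat w₀ w hw₀ hw]
      exact h _ (hA _ v hv)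
  refine ⟨hA, fun w hw => ⟨hleft w hw, fun v hv h => hleft w hw v hv fun x hx => ?_⟩⟩
  have hh := hB.hermitian w hw v (ρ (sqKer π w)⁻¹ x)
  rwa [Representation.self_inv_apply, h _ (hA _ x hx), map_zero] at hh

/-- A proper simple submodule of an irreducible representation is isotropic. -/
theorem isotropic_of_simple (hB : IsHermRep K ι π ρ B) (hirr : IsIrredRep K π ρ B)
    (hw₀ : π w₀ = -1) (hA : IsSimpleGSub K π ρ A) (htop : A ≠ ⊤) :
    ∀ u ∈ A, ∀ v ∈ A, B w₀ u v = 0 := by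
  let rad : Submodule K V :=
    { carrier := {u | u ∈ A ∧ ∀ v ∈ A, B w₀ u v = 0}
      add_mem' := fun {a b} ha hb => ⟨A.add_mem ha.1 hb.1, fun v hv => by
        rw [hB.add_left w₀ hw₀, ha.2 v hv, hb.2 v hv, add_zero]⟩
      zero_mem' := ⟨A.zero_mem, fun v _ => by
        simpa using hB.smul_left w₀ hw₀ 0 0 v⟩
      smul_mem' := fun c u hu => ⟨A.smul_mem c hu.1, fun v hv => by
        rw [hB.smul_left w₀ hw₀, hu.2 v hv, mul_zero]⟩ }
  rcases hA.2.2 rad (fun u hu => hu.1) (fun g u hu => ⟨hA.1 g u hu.1, fun v hv => by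
      rw [← Representation.self_inv_apply ρ (conjKer π w₀ g) v, hB.invariant w₀ hw₀]
      exact hu.2 _ (hA.1 _ v hv)⟩) with h | h
  · have hsub := hB.isSubrep_of_nondeg_left hw₀ hA.1 fun u hu h0 =>
      (Submodule.eq_bot_iff rad).mp h u ⟨hu, h0⟩
    exact absurd (hirr.2 A hsub) (not_or.mpr ⟨hA.2.1, htop⟩)
  · intro u hu v hv
    rw [← h] at hu
    exact hu.2 v hv

end IsHermRep

/-- Subcase B1 of the structure theorem for irreducible `L`-representations: if
`V = W ⊕ W'` with `W, W'` simple, `W^⊥ = W` and `W ≇ W'` as `ℂG`-modules, then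
`Aut_L(V) ≅ ℂˣ` as groups. -/
theorem irred_L_rep_caseB1_aut
    {Ghat : Type} [Group Ghat] [Finite Ghat] (π : Ghat →* ℤˣ)
    (hπ : Function.Surjective π)
    {V : Type} [AddCommGroup V] [Module ℂ V] [FiniteDimensional ℂ V]
    (ρ : Representation ℂ π.ker V) (B : Ghat → V → V → ℂ)
    (hB : IsLRep π ρ B) (hirr : IsIrredRep ℂ π ρ B)
    (W W' : Submodule ℂ V) (hW : IsSimpleGSub ℂ π ρ W) (hW' : IsSimpleGSub ℂ π ρ W')
    (hmeet : W ⊓ W' = ⊥) (hjoin : W ⊔ W' = ⊤)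
    (w₀ : Ghat) (hw₀ : π w₀ = -1) (hperp : perp B W w₀ = (W : Set V))
    (hniso : ¬ ∃ f : V →ₗ[ℂ] V, Set.InjOn f W ∧ Submodule.map f W = W' ∧
        ∀ (g : π.ker), ∀ u ∈ W, f (ρ g u) = ρ g (f u)) :
    Nonempty (AutRep ℂ π ρ B ≃* ℂˣ) := by
  have hc : IsCompl W W' := IsCompl.of_eq hmeet hjoin
  have hWiso : ∀ u ∈ W, ∀ v ∈ W, B w₀ u v = 0 := fun u hu v hv =>
    (hperp.symm ▸ hv : v ∈ perp B W w₀) u hu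
  have hW'iso : ∀ u ∈ W', ∀ v ∈ W', B w₀ u v = 0 :=
    hB.isotropic_of_simple hirr hw₀ hW' fun h => hW.2.1 (by rwa [h, inf_top_eq] at hmeet)
  have hP := projection_map_rep ρ hc hW.1 hW'.1
  have hQ := projection_map_rep ρ hc.symm hW'.1 hW.1
  have hPmem := Submodule.projection_apply_mem hc
  have hQmem := Submodule.projection_apply_mem hc.symm
  have hmem : ∀ c : ℂˣ, hyperbolicScaling hc c ∈ AutRep ℂ π ρ B := by
    intro c
    have hequiv : ∀ (g : π.ker) (v : V),
        hyperbolicScaling hc c (ρ g v) = ρ g (hyperbolicScaling hc c v) := fun g v => by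
      simp only [hyperbolicScaling_apply, hP, hQ, map_add, map_smul]
    refine ⟨hequiv, fun w hw u v => ?_⟩
    rw [hB.compat w w₀ hw hw₀, hB.compat w w₀ hw hw₀, ← hequiv]
    generalize ρ _ v = x
    conv_rhs => rw [← Submodule.projection_add_projection_eq_self hc u,
      ← Submodule.projection_add_projection_eq_self hc x]
    simp only [hyperbolicScaling_apply, hB.add_left w₀ hw₀, hB.add_right w₀ hw₀,
      hB.smul_left w₀ hw₀, hB.smul_right w₀ hw₀, RingHom.id_apply,
      hWiso _ (hPmem _) _ (hPmem _), hW'iso _ (hQmem _) _ (hQmem _)]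
    simp
  refine ⟨(MulEquiv.ofBijective
    ((hyperbolicScaling hc).codRestrict (AutRep ℂ π ρ B) hmem) ⟨?_, ?_⟩).symm⟩
  · intro c d hcd
    obtain ⟨x, hx, hx0⟩ := W.exists_mem_ne_zero_of_ne_bot hW.2.1
    have h1 := LinearEquiv.congr_fun (congrArg Subtype.val hcd) x
    change hyperbolicScaling hc c x = hyperbolicScaling hc d x at h1
    rw [hyperbolicScaling_apply, hyperbolicScaling_apply,
      Submodule.projection_apply_of_mem_left hc hx,
      (Submodule.projection_apply_eq_zero_iff hc.symm).mpr hx, smul_zero, smul_zero,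
      add_zero, add_zero] at h1
    exact Units.ext (smul_left_injective ℂ hx0 h1)
  · rintro ⟨f, hf, hfB⟩
    have hfW : ∀ v ∈ W, f v ∈ W := by
      rcases hW.eq_zero_or_bijective hW' (W'.projection W hc.symm ∘ₗ f.toLinearMap)
        (fun v _ => hQmem _) (fun g v _ => by simp [hf, hQ]) with h | h
      · exact fun v hv => (Submodule.projection_apply_eq_zero_iff hc.symm).mp (h v hv)
      · exact absurd ⟨_, h.1, h.2, fun g v _ => by simp [hf, hQ]⟩ hniso
    have hfW' : ∀ v ∈ W', f v ∈ W' := by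
      rcases hW'.eq_zero_or_bijective hW (W.projection W' hc ∘ₗ f.toLinearMap)
        (fun v _ => hPmem _) (fun g v _ => by simp [hf, hP]) with h | h
      · exact fun v hv => (Submodule.projection_apply_eq_zero_iff hc).mp (h v hv)
      · exact absurd (hW'.exists_inverse _ h.1 h.2 fun g v _ => by simp [hf, hP]) hniso
    obtain ⟨a, ha⟩ := hW.exists_scalar f.toLinearMap hfW fun g v _ => hf g v
    obtain ⟨b, hb⟩ := hW'.exists_scalar f.toLinearMap hfW' fun g v _ => hf g v
    obtain ⟨x, hx, hx0⟩ := W.exists_mem_ne_zero_of_ne_bot hW.2.1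
    have hab : a * b = 1 := by
      by_contra hab
      refine hx0 (hB.nondeg_left w₀ hw₀ x fun v => ?_)
      rw [← Submodule.projection_add_projection_eq_self hc v, hB.add_right w₀ hw₀,
        hWiso x hx _ (hPmem v), zero_add]
      have h1 := hfB w₀ hw₀ x (W'.projection W hc.symm v)
      have h2 : f x = a • x := ha x hx
      have h3 : f (W'.projection W hc.symm v) = b • W'.projection W hc.symm v :=
        hb _ (hQmem v)
      rw [h2, h3, hB.smul_left w₀ hw₀, hB.smul_right w₀ hw₀, RingHom.id_apply, ← mul_assoc] at h1
      exact (mul_left_eq_self₀.mp h1).resolve_left hab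
    refine ⟨⟨a, b, hab, by rw [mul_comm, hab]⟩, Subtype.ext (LinearEquiv.ext fun v => ?_)⟩
    change hyperbolicScaling hc _ v = f v
    conv_rhs => rw [← Submodule.projection_add_projection_eq_self hc v, map_add]
    rw [hyperbolicScaling_apply]
    exact congrArg₂ (· + ·) (ha _ (hPmem v)).symm (hb _ (hQmem v)).symm
end

section
/- Let (Ĝ, π) be a C₂-graded finite group and let (V, (B_w)) be an irreducible L-representation of (Ĝ, π) whose underlying ℂG-module decomposes as V = W ⊕ W' with W, W' simple ℂG-submodules, W^⊥ = W (with respect to any odd w), and W isomorphic to W' as ℂG-modules. Then: (1) for any odd w, the simple ℂG-module W carries a nondegenerate bilinear form D : W × W → ℂ satisfying D(g·u, (wgw⁻¹)·v) = D(u, v) for all g ∈ G and D(u, w²·v) = −D(v, u) for all u, v ∈ W (i.e. a w-invariant, w-alternating form); and (2) the group Aut_L(V) of L-automorphisms of V is isomorphic, as a group, to SL₂(ℂ). -/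
open scoped ComplexConjugate

section HermRep

variable {Ghat : Type} [Group Ghat] {K : Type} [Field K] {π : Ghat →* ℤˣ}
  {V : Type} [AddCommGroup V] [Module K V] {ρ : Representation K π.ker V}

/-- The action of a group element undoes the action of its inverse. -/
theorem Representation.apply_apply_inv {G : Type} [Group G] (ρ : Representation K G V)
    (g : G) (v : V) : ρ g (ρ g⁻¹ v) = v := by
  rw [← Module.End.mul_apply, ← map_mul, mul_inv_cancel, map_one, Module.End.one_apply]

/-- A form of a hermitian representation restricted to a simple `G`-submodule either vanishes or
makes the submodule a subrepresentation. -/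
theorem IsHermRep.eq_zero_or_isSubrep {ι : K →+* K} {B : Ghat → V → V → K}
    (hB : IsHermRep K ι π ρ B) {U : Submodule K V} (hU : IsSimpleGSub K π ρ U)
    {w₀ : Ghat} (hw₀ : π w₀ = -1) :
    (∀ u ∈ U, ∀ v ∈ U, B w₀ u v = 0) ∨ IsSubrep K π ρ B U := by
  have hzero : ∀ v, B w₀ 0 v = 0 := fun v => by
    simpa using hB.smul_left w₀ hw₀ 0 0 v
  let R : Submodule K V :=
    { carrier := {u | u ∈ U ∧ ∀ v ∈ U, B w₀ u v = 0}
      zero_mem' := ⟨U.zero_mem, fun v _ => hzero v⟩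
      add_mem' := by
        rintro a b ⟨ha, ha'⟩ ⟨hb, hb'⟩
        refine ⟨U.add_mem ha hb, fun v hv => ?_⟩
        rw [hB.add_left w₀ hw₀, ha' v hv, hb' v hv, add_zero]
      smul_mem' := by
        rintro c a ⟨ha, ha'⟩
        refine ⟨U.smul_mem c ha, fun v hv => ?_⟩
        rw [hB.smul_left w₀ hw₀, ha' v hv, mul_zero] }
  have hR : ∀ (g : π.ker), ∀ v ∈ R, ρ g v ∈ R := by
    rintro g u ⟨hu, hu'⟩
    refine ⟨hU.1 g u hu, fun v hv => ?_⟩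
    rw [← ρ.apply_apply_inv (conjKer π w₀ g) v, hB.invariant w₀ hw₀]
    exact hu' _ (hU.1 _ v hv)
  rcases hU.2.2 R (fun u hu => hu.1) hR with h | h
  · right
    have hleft : ∀ w, π w = -1 → ∀ u ∈ U, (∀ v ∈ U, B w u v = 0) → u = 0 := by
      intro w hw u hu huv
      have : u ∈ R := by
        refine ⟨hu, fun v hv => ?_⟩
        rw [hB.compat w₀ w hw₀ hw]
        exact huv _ (hU.1 _ v hv)
      rwa [h, Submodule.mem_bot] at this
    refine ⟨hU.1, fun w hw => ⟨hleft w hw, fun v hv hvu => ?_⟩⟩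
    have hs : ρ (sqKer π w)⁻¹ v = 0 := by
      refine hleft w hw _ (hU.1 _ v hv) fun u hu => ι.injective ?_
      rw [← hB.hermitian w hw, ρ.apply_apply_inv, hvu u hu, map_zero]
    rw [← ρ.apply_apply_inv (sqKer π w) v, hs, map_zero]
  · left
    intro u hu v hv
    rw [← h] at hu
    exact hu.2 v hv

/-- An irreducible hermitian representation is totally isotropic on each proper simple
`G`-submodule. -/
theorem IsHermRep.eq_zero_of_isSimpleGSub {ι : K →+* K} {B : Ghat → V → V → K}
    (hB : IsHermRep K ι π ρ B) (hirr : IsIrredRep K π ρ B)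
    {U : Submodule K V} (hU : IsSimpleGSub K π ρ U) (hU' : U ≠ ⊤)
    {w₀ : Ghat} (hw₀ : π w₀ = -1) {u v : V} (hu : u ∈ U) (hv : v ∈ U) : B w₀ u v = 0 := by
  rcases hB.eq_zero_or_isSubrep hU hw₀ with h | h
  · exact h u hu v hv
  · exact ((hirr.2 U h).elim hU.2.1 hU').elim

/-- The image of a simple `G`-submodule under an injective equivariant map is simple. -/
theorem IsSimpleGSub.map {W : Submodule K V} (hW : IsSimpleGSub K π ρ W) (φ : V →ₗ[K] V)
    (hφ : Set.InjOn φ W) (hφρ : ∀ (g : π.ker), ∀ u ∈ W, φ (ρ g u) = ρ g (φ u)) :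
    IsSimpleGSub K π ρ (W.map φ) := by
  refine ⟨?_, ?_, ?_⟩
  · rintro g _ ⟨u, hu, rfl⟩
    exact ⟨ρ g u, hW.1 g u hu, hφρ g u hu⟩
  · intro h
    refine hW.2.1 ((Submodule.eq_bot_iff _).2 fun u hu => hφ hu W.zero_mem ?_)
    rw [map_zero, ← Submodule.mem_bot K, ← h]
    exact ⟨u, hu, rfl⟩
  · intro U hUW hU
    have key := hW.2.2 (W ⊓ U.comap φ) inf_le_left (by
      rintro g u ⟨hu, hu'⟩
      refine ⟨hW.1 g u hu, ?_⟩
      change φ (ρ g u) ∈ U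
      rw [hφρ g u hu]
      exact hU g _ hu')
    rcases key with h | h
    · left
      refine (Submodule.eq_bot_iff _).2 fun x hx => ?_
      obtain ⟨u, hu, rfl⟩ := hUW hx
      have : u ∈ W ⊓ U.comap φ := ⟨hu, hx⟩
      rw [h, Submodule.mem_bot] at this
      rw [this, map_zero]
    · right
      refine le_antisymm hUW ?_
      rintro _ ⟨u, hu, rfl⟩
      rw [SetLike.mem_coe, ← h] at hu
      exact hu.2

/-- **Schur's lemma** for a simple `G`-submodule. -/
theorem IsSimpleGSub.exists_eq_smul [IsAlgClosed K] [FiniteDimensional K V]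
    {W : Submodule K V} (hW : IsSimpleGSub K π ρ W) (h : W →ₗ[K] W)
    (hρ : ∀ (g : π.ker) (u : W), h ((ρ g).restrict (hW.1 g) u) = (ρ g).restrict (hW.1 g) (h u)) :
    ∃ c : K, ∀ u, h u = c • u := by
  have : Nontrivial W := Submodule.nontrivial_iff_ne_bot.2 hW.2.1
  obtain ⟨c, hc⟩ := Module.End.exists_eigenvalue h
  obtain ⟨u₀, hu₀⟩ := hc.exists_hasEigenvector
  refine ⟨c, fun u => ?_⟩
  have key := hW.2.2 ((Module.End.eigenspace h c).map W.subtype) (Submodule.map_subtype_le _ _) (by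
    rintro g _ ⟨v, hv, rfl⟩
    refine ⟨(ρ g).restrict (hW.1 g) v, ?_, rfl⟩
    rw [SetLike.mem_coe, Module.End.mem_eigenspace_iff] at hv ⊢
    rw [hρ, hv, map_smul])
  rcases key with h' | h'
  · refine (hu₀.2 ?_).elim
    have : (u₀ : V) ∈ (Module.End.eigenspace h c).map W.subtype := ⟨u₀, hu₀.1, rfl⟩
    rw [h', Submodule.mem_bot] at this
    exact Subtype.ext this
  · have : (u : V) ∈ (Module.End.eigenspace h c).map W.subtype := by
      rw [h']
      exact u.2
    obtain ⟨v, hv, hvu⟩ := this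
    obtain rfl : v = u := Subtype.ext hvu
    exact Module.End.mem_eigenspace_iff.1 hv

end HermRep

section MatrixAction

variable {K M V : Type} [Field K] [AddCommGroup M] [Module K M] [AddCommGroup V] [Module K V]

/-- The action of `2 × 2` matrices on a space `V` identified with `M × M`. -/
def matrixProdEnd (e : (M × M) ≃ₗ[K] V) (A : Matrix (Fin 2) (Fin 2) K) : V →ₗ[K] V :=
  e.toLinearMap ∘ₗ
    LinearMap.prod (A 0 0 • LinearMap.fst K M M + A 0 1 • LinearMap.snd K M M)
      (A 1 0 • LinearMap.fst K M M + A 1 1 • LinearMap.snd K M M) ∘ₗ e.symm.toLinearMap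

theorem matrixProdEnd_apply (e : (M × M) ≃ₗ[K] V) (A : Matrix (Fin 2) (Fin 2) K) (u v : M) :
    matrixProdEnd e A (e (u, v)) = e (A 0 0 • u + A 0 1 • v, A 1 0 • u + A 1 1 • v) := by
  simp [matrixProdEnd]

theorem matrixProdEnd_one (e : (M × M) ≃ₗ[K] V) (x : V) : matrixProdEnd e 1 x = x := by
  obtain ⟨⟨u, v⟩, rfl⟩ := e.surjective x
  simp [matrixProdEnd_apply]

theorem matrixProdEnd_mul (e : (M × M) ≃ₗ[K] V) (A A' : Matrix (Fin 2) (Fin 2) K) (x : V) :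
    matrixProdEnd e (A * A') x = matrixProdEnd e A (matrixProdEnd e A' x) := by
  obtain ⟨⟨u, v⟩, rfl⟩ := e.surjective x
  simp only [matrixProdEnd_apply, Matrix.mul_apply, Fin.sum_univ_two]
  congr 2 <;> module

/-- The action of `SL₂(K)` on a space identified with `M × M`. -/
def specialLinearProdEquiv (e : (M × M) ≃ₗ[K] V) :
    Matrix.SpecialLinearGroup (Fin 2) K →* (V ≃ₗ[K] V) where
  toFun A := LinearEquiv.ofLinearMap (matrixProdEnd e A.1) (matrixProdEnd e (A⁻¹).1)
    (LinearMap.ext fun x => by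
      rw [LinearMap.comp_apply, ← matrixProdEnd_mul, ← Matrix.SpecialLinearGroup.coe_mul,
        mul_inv_cancel, Matrix.SpecialLinearGroup.coe_one, matrixProdEnd_one, LinearMap.id_apply])
    (LinearMap.ext fun x => by
      rw [LinearMap.comp_apply, ← matrixProdEnd_mul, ← Matrix.SpecialLinearGroup.coe_mul,
        inv_mul_cancel, Matrix.SpecialLinearGroup.coe_one, matrixProdEnd_one, LinearMap.id_apply])
  map_one' := LinearEquiv.ext fun x => matrixProdEnd_one e x
  map_mul' A A' := LinearEquiv.ext fun x => matrixProdEnd_mul e A.1 A'.1 x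

theorem specialLinearProdEquiv_apply (e : (M × M) ≃ₗ[K] V)
    (A : Matrix.SpecialLinearGroup (Fin 2) K) (u v : M) :
    specialLinearProdEquiv e A (e (u, v)) =
      e (A 0 0 • u + A 0 1 • v, A 1 0 • u + A 1 1 • v) :=
  matrixProdEnd_apply e A.1 u v

theorem specialLinearProdEquiv_injective [Nontrivial M] (e : (M × M) ≃ₗ[K] V) :
    Function.Injective (specialLinearProdEquiv e) := by
  intro A A' h
  obtain ⟨m, hm⟩ := exists_ne (0 : M)
  have h₁ := LinearEquiv.congr_fun h (e (m, 0))
  have h₂ := LinearEquiv.congr_fun h (e (0, m))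
  simp only [specialLinearProdEquiv_apply, EmbeddingLike.apply_eq_iff_eq, Prod.mk.injEq, smul_zero,
    add_zero, zero_add] at h₁ h₂
  ext i j
  fin_cases i <;> fin_cases j
  · exact smul_left_injective K hm h₁.1
  · exact smul_left_injective K hm h₂.1
  · exact smul_left_injective K hm h₁.2
  · exact smul_left_injective K hm h₂.2

end MatrixAction

/-- If `V ≅ W × W` equivariantly with `W` simple, and one form of `V` is the hyperbolic form
`D(u, v') - D(u', v)` for a nonzero `D`, then the automorphism group of `V` is `SL₂`. -/
theorem IsHermRep.nonempty_autRep_mulEquiv {Ghat : Type} [Group Ghat] {π : Ghat →* ℤˣ}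
    {K : Type} [Field K] [IsAlgClosed K] {ι : K →+* K}
    {V : Type} [AddCommGroup V] [Module K V] [FiniteDimensional K V]
    {ρ : Representation K π.ker V} {B : Ghat → V → V → K} (hB : IsHermRep K ι π ρ B)
    {W : Submodule K V} (hW : IsSimpleGSub K π ρ W) (e : (W × W) ≃ₗ[K] V)
    (he : ∀ (g : π.ker) (u v : W),
      ρ g (e (u, v)) = e ((ρ g).restrict (hW.1 g) u, (ρ g).restrict (hW.1 g) v))
    {w₀ : Ghat} (hw₀ : π w₀ = -1) (D : W →ₗ[K] W →ₗ[K] K) (hD : D ≠ 0)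
    (hBD : ∀ u u' v v' : W, B w₀ (e (u, u')) (e (v, v')) = D u v' - D u' v) :
    Nonempty (AutRep K π ρ B ≃* Matrix.SpecialLinearGroup (Fin 2) K) := by
  have : Nontrivial W := Submodule.nontrivial_iff_ne_bot.2 hW.2.1
  have hmem : ∀ A, specialLinearProdEquiv e A ∈ AutRep K π ρ B := by
    intro A
    have hA : ∀ (g : π.ker) (v : V),
        specialLinearProdEquiv e A (ρ g v) = ρ g (specialLinearProdEquiv e A v) := by
      intro g v
      obtain ⟨⟨u, v⟩, rfl⟩ := e.surjective v
      simp only [he, specialLinearProdEquiv_apply, map_add, map_smul]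
    refine ⟨hA, fun w hw x y => ?_⟩
    rw [hB.compat w w₀ hw hw₀, hB.compat w w₀ hw hw₀, ← hA]
    generalize ρ (ratioKer π w₀ w hw₀ hw) y = y
    obtain ⟨⟨u, u'⟩, rfl⟩ := e.surjective x
    obtain ⟨⟨v, v'⟩, rfl⟩ := e.surjective y
    have hdet := A.det_coe
    rw [Matrix.det_fin_two] at hdet
    simp only [specialLinearProdEquiv_apply, hBD, map_add, map_smul, LinearMap.add_apply,
      LinearMap.smul_apply, smul_eq_mul]
    linear_combination (D u v' - D u' v) * hdet
  refine ⟨(MulEquiv.ofBijective ((specialLinearProdEquiv e).codRestrict _ hmem) ⟨?_, ?_⟩).symm⟩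
  · intro A A' h
    exact specialLinearProdEquiv_injective e (congrArg Subtype.val h)
  · rintro ⟨T, hT, hTB⟩
    have hesymm : ∀ (g : π.ker) (x : V), e.symm (ρ g x) =
        ((ρ g).restrict (hW.1 g) (e.symm x).1, (ρ g).restrict (hW.1 g) (e.symm x).2) := by
      intro g x
      rw [LinearEquiv.symm_apply_eq, ← he, Prod.mk.eta, LinearEquiv.apply_symm_apply]
    have schur : ∀ (i : W →ₗ[K] W × W) (p : W × W →ₗ[K] W),
        (∀ g u, e (i ((ρ g).restrict (hW.1 g) u)) = ρ g (e (i u))) →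
        (∀ g x, p (e.symm (ρ g x)) = (ρ g).restrict (hW.1 g) (p (e.symm x))) →
        ∃ c : K, ∀ u, p (e.symm (T (e (i u)))) = c • u := fun i p hi hp =>
      hW.exists_eq_smul (p ∘ₗ e.symm.toLinearMap ∘ₗ T.toLinearMap ∘ₗ e.toLinearMap ∘ₗ i)
        fun g u => by simp [hi, hT, hp]
    have hinl : ∀ g u, e (LinearMap.inl K W W ((ρ g).restrict (hW.1 g) u)) =
        ρ g (e (LinearMap.inl K W W u)) := fun g u => by
      simp only [LinearMap.inl_apply, he, map_zero]
    have hinr : ∀ g u, e (LinearMap.inr K W W ((ρ g).restrict (hW.1 g) u)) =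
        ρ g (e (LinearMap.inr K W W u)) := fun g u => by
      simp only [LinearMap.inr_apply, he, map_zero]
    obtain ⟨a, ha⟩ := schur (.inl K W W) (.fst K W W) hinl fun g x => by simp [hesymm]
    obtain ⟨b, hb⟩ := schur (.inr K W W) (.fst K W W) hinr fun g x => by simp [hesymm]
    obtain ⟨c, hc⟩ := schur (.inl K W W) (.snd K W W) hinl fun g x => by simp [hesymm]
    obtain ⟨d, hd⟩ := schur (.inr K W W) (.snd K W W) hinr fun g x => by simp [hesymm]
    have hTl : ∀ u : W, T (e (u, 0)) = e (a • u, c • u) := fun u => by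
      rw [← LinearEquiv.symm_apply_eq]
      exact Prod.ext (ha u) (hc u)
    have hTr : ∀ u : W, T (e (0, u)) = e (b • u, d • u) := fun u => by
      rw [← LinearEquiv.symm_apply_eq]
      exact Prod.ext (hb u) (hd u)
    have hdet : a * d - b * c = 1 := by
      obtain ⟨u, v, huv⟩ : ∃ u v, D u v ≠ 0 := by
        by_contra! h
        exact hD (LinearMap.ext₂ h)
      have := hTB w₀ hw₀ (e (u, 0)) (e (0, v))
      simp only [hTl, hTr, hBD, map_smul, LinearMap.smul_apply, smul_eq_mul, map_zero,
        sub_zero] at this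
      refine mul_right_cancel₀ huv ?_
      linear_combination this
    have hdet' : (Matrix.of ![![a, b], ![c, d]]).det = 1 := by
      simpa [Matrix.det_fin_two] using hdet
    refine ⟨⟨Matrix.of ![![a, b], ![c, d]], hdet'⟩, Subtype.ext (LinearEquiv.ext fun x => ?_)⟩
    obtain ⟨⟨u, v⟩, rfl⟩ := e.surjective x
    have huv : e (u, v) = e (u, 0) + e (0, v) := by simp [← map_add]
    refine (specialLinearProdEquiv_apply e _ u v).trans ?_
    rw [huv, map_add, hTl, hTr, ← map_add]
    rfl

/-- Subcase B2 of the structure theorem for irreducible `L`-representations: if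
`V = W ⊕ W'` with `W, W'` simple, `W^⊥ = W` and `W ≅ W'` as `ℂG`-modules, then `W` carries a
nondegenerate `w`-invariant `w`-alternating bilinear form, and `Aut_L(V) ≅ SL₂(ℂ)` as groups. -/
theorem irred_L_rep_caseB2
    {Ghat : Type} [Group Ghat] [Finite Ghat] (π : Ghat →* ℤˣ)
    (hπ : Function.Surjective π)
    {V : Type} [AddCommGroup V] [Module ℂ V] [FiniteDimensional ℂ V]
    (ρ : Representation ℂ π.ker V) (B : Ghat → V → V → ℂ)
    (hB : IsLRep π ρ B) (hirr : IsIrredRep ℂ π ρ B)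
    (W W' : Submodule ℂ V) (hW : IsSimpleGSub ℂ π ρ W) (hW' : IsSimpleGSub ℂ π ρ W')
    (hmeet : W ⊓ W' = ⊥) (hjoin : W ⊔ W' = ⊤)
    (w₀ : Ghat) (hw₀ : π w₀ = -1) (hperp : perp B W w₀ = (W : Set V))
    (hiso : ∃ f : V →ₗ[ℂ] V, Set.InjOn f W ∧ Submodule.map f W = W' ∧
        ∀ (g : π.ker), ∀ u ∈ W, f (ρ g u) = ρ g (f u)) :
    (∃ D : V →ₗ[ℂ] V →ₗ[ℂ] ℂ,
      (∀ u ∈ W, (∀ v ∈ W, D u v = 0) → u = 0) ∧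
      (∀ v ∈ W, (∀ u ∈ W, D u v = 0) → v = 0) ∧
      (∀ (g : π.ker), ∀ u ∈ W, ∀ v ∈ W, D (ρ g u) (ρ (conjKer π w₀ g) v) = D u v) ∧
      (∀ u ∈ W, ∀ v ∈ W, D u (ρ (sqKer π w₀) v) = -(D v u))) ∧
    Nonempty (AutRep ℂ π ρ B ≃* Matrix.SpecialLinearGroup (Fin 2) ℂ) := by
  obtain ⟨f, hfinj, hfmap, hfρ⟩ := hiso
  have hfW : ∀ u ∈ W, f u ∈ W' := fun u hu => hfmap ▸ ⟨u, hu, rfl⟩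
  have hdisj : ∀ x ∈ W, x ∈ W' → x = 0 := fun x hx hx' => by
    rw [← Submodule.mem_bot ℂ, ← hmeet]
    exact ⟨hx, hx'⟩
  have hf0 : ∀ u ∈ W, f u = 0 → u = 0 := fun u hu h =>
    hfinj hu W.zero_mem (h.trans (map_zero f).symm)
  let b : V →ₗ[ℂ] V →ₗ[ℂ] ℂ := LinearMap.mk₂ ℂ (B w₀) (hB.add_left w₀ hw₀)
    (hB.smul_left w₀ hw₀) (hB.add_right w₀ hw₀) (hB.smul_right w₀ hw₀)
  have hb : ∀ u v, B w₀ u v = b u v := fun _ _ => rfl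
  have hWW : ∀ u ∈ W, ∀ v ∈ W, b u v = 0 := fun u hu v hv => by
    have : v ∈ perp B W w₀ := hperp ▸ hv
    exact this u hu
  have hW'top : W' ≠ ⊤ := by
    rintro rfl
    exact hW.2.1 (by simpa using hmeet)
  have hW'W' : ∀ u ∈ W, ∀ v ∈ W, b (f u) (f v) = 0 := fun u hu v hv =>
    hB.eq_zero_of_isSimpleGSub hirr hW' hW'top hw₀ (hfW u hu) (hfW v hv)
  have hinj : Set.InjOn (LinearMap.id + f : V →ₗ[ℂ] V) W := by
    intro u hu v hv huv
    simp only [LinearMap.add_apply, LinearMap.id_apply] at huv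
    have h₁ : u - v = f (v - u) := by
      rw [map_sub, sub_eq_sub_iff_add_eq_add, huv, add_comm]
    refine sub_eq_zero.1 (hdisj _ (W.sub_mem hu hv) ?_)
    rw [h₁]
    exact hfW _ (W.sub_mem hv hu)
  have hdiag : IsSimpleGSub ℂ π ρ (W.map (LinearMap.id + f)) :=
    hW.map _ hinj fun g u hu => by simp [hfρ g u hu]
  have hdiagtop : W.map (LinearMap.id + f) ≠ ⊤ := by
    intro h
    refine hW.2.1 ((Submodule.eq_bot_iff _).2 fun x hx => ?_)
    obtain ⟨u, hu, hux⟩ : x ∈ W.map (LinearMap.id + f) := h ▸ Submodule.mem_top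
    simp only [LinearMap.add_apply, LinearMap.id_apply] at hux
    have hfu : f u = x - u := by rw [← hux, add_sub_cancel_left]
    have hu0 : u = 0 :=
      hf0 u hu (hdisj _ (hfu ▸ W.sub_mem hx hu) (hfW u hu))
    rw [← hux, hu0, map_zero, add_zero]
  have hskew : ∀ u ∈ W, ∀ v ∈ W, b (f u) v = -b u (f v) := fun u hu v hv => by
    have := hB.eq_zero_of_isSimpleGSub hirr hdiag hdiagtop hw₀
      (Submodule.mem_map_of_mem hu) (Submodule.mem_map_of_mem hv)
    simp only [hb, LinearMap.add_apply, LinearMap.id_apply, map_add, hWW u hu v hv,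
      hW'W' u hu v hv] at this
    linear_combination this
  have hnondeg : ∀ u ∈ W, (∀ v ∈ W, b u (f v) = 0) → u = 0 := fun u hu h => by
    refine hB.nondeg_left w₀ hw₀ u fun x => ?_
    obtain ⟨y, hy, z, hz, rfl⟩ := Submodule.mem_sup.1 (hjoin ▸ Submodule.mem_top : x ∈ W ⊔ W')
    rw [← hfmap] at hz
    obtain ⟨v, hv, rfl⟩ := hz
    rw [hb, map_add, hWW u hu y hy, h v hv, add_zero]
  refine ⟨⟨b.compl₂ f, hnondeg, fun v hv h => ?_, fun g u hu v hv => ?_, fun u hu v hv => ?_⟩, ?_⟩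
  · have : f v ∈ perp B W w₀ := h
    rw [hperp] at this
    exact hf0 v hv (hdisj _ this (hfW v hv))
  · simp only [LinearMap.compl₂_apply, hfρ _ v hv, ← hb]
    exact hB.invariant w₀ hw₀ g u (f v)
  · rw [LinearMap.compl₂_apply, LinearMap.compl₂_apply, hfρ _ v hv, ← hskew v hv u hu]
    exact hB.hermitian w₀ hw₀ u (f v)
  · have hbij : Function.Bijective (W.subtype.coprod (f ∘ₗ W.subtype)) := by
      constructor
      · rw [injective_iff_map_eq_zero]
        rintro ⟨u, v⟩ h
        simp only [LinearMap.coprod_apply, LinearMap.comp_apply, Submodule.subtype_apply] at h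
        have hu : (u : V) = 0 := by
          refine hdisj _ u.2 ?_
          rw [eq_neg_of_add_eq_zero_left h]
          exact W'.neg_mem (hfW v v.2)
        rw [hu, zero_add] at h
        exact Prod.ext (Subtype.ext hu) (Subtype.ext (hf0 v v.2 h))
      · intro x
        obtain ⟨y, hy, z, hz, rfl⟩ :=
          Submodule.mem_sup.1 (hjoin ▸ Submodule.mem_top : x ∈ W ⊔ W')
        rw [← hfmap] at hz
        obtain ⟨v, hv, rfl⟩ := hz
        exact ⟨(⟨y, hy⟩, ⟨v, hv⟩), by simp⟩
    obtain ⟨e, he⟩ : ∃ e : (W × W) ≃ₗ[ℂ] V, ∀ u v : W, e (u, v) = (u : V) + f v :=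
      ⟨LinearEquiv.ofBijective _ hbij, fun u v => LinearMap.coprod_apply _ _ _⟩
    refine hB.nonempty_autRep_mulEquiv hW e (fun g u v => ?_) hw₀
      ((b.compl₂ f).domRestrict₁₂ W W) (fun h => ?_) fun u u' v v' => ?_
    · simp [he, hfρ g v v.2]
    · refine hW.2.1 ((Submodule.eq_bot_iff _).2 fun u hu => hnondeg u hu fun v hv => ?_)
      exact LinearMap.congr_fun₂ h ⟨u, hu⟩ ⟨v, hv⟩
    · simp only [he, hb, map_add, LinearMap.add_apply, hWW u u.2 v v.2, hW'W' u' u'.2 v' v'.2,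
        hskew u' u'.2 v v.2, LinearMap.domRestrict₁₂_apply, LinearMap.compl₂_apply]
      ring
end

section
/- Let (Ĝ, π) be a C₂-graded finite group. If (V, ρ, (B_w)) and (Ṽ, ρ̃, (B̃_w)) are L-representations of (Ĝ, π) whose underlying ℂG-modules (V, ρ) and (Ṽ, ρ̃) are isomorphic as ℂG-modules, then (V, ρ, (B_w)) and (Ṽ, ρ̃, (B̃_w)) are isomorphic as L-representations; that is, an L-representation is determined up to isomorphism by its underlying ℂG-module. -/
open scoped ComplexConjugate

section SquareRoots

open Polynomial

/-- Over an algebraically closed field of characteristic not two, `X` is a square modulo any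
product of linear factors `X - a` with `a ≠ 0`. -/
theorem exists_prod_X_sub_C_dvd_sq_sub_X {K : Type*} [Field K] [IsAlgClosed K]
    (h2 : (2 : K) ≠ 0) (s : Multiset K) (hs : (0 : K) ∉ s) :
    ∃ p : K[X], (s.map fun a => X - C a).prod ∣ p ^ 2 - X := by
  induction s using Multiset.induction_on with
  | empty => exact ⟨0, by simp⟩
  | cons a s ih =>
    obtain ⟨p, k, hk⟩ := ih fun h => hs (Multiset.mem_cons_of_mem h)
    have ha : a ≠ 0 := fun h => hs (h ▸ Multiset.mem_cons_self a s)
    set f : K[X] := (s.map fun a => X - C a).prod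
    have hka : p.eval a ^ 2 - a = f.eval a * k.eval a := by
      simpa using congrArg (Polynomial.eval a) hk
    obtain ⟨c, hc⟩ : ∃ c : K, k.eval a + 2 * p.eval a * c + f.eval a * c ^ 2 = 0 := by
      by_cases hf : f.eval a = 0
      · have hp : p.eval a ≠ 0 := by
          intro hp
          rw [hp, hf] at hka
          apply ha
          linear_combination -hka
        refine ⟨-k.eval a / (2 * p.eval a), ?_⟩
        rw [hf]
        field_simp
        ring
      · obtain ⟨t, ht⟩ := IsAlgClosed.exists_pow_nat_eq a two_pos
        refine ⟨(-p.eval a + t) / f.eval a, ?_⟩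
        field_simp
        linear_combination ht - hka
    refine ⟨p + f * C c, ?_⟩
    have hroot : X - C a ∣ k + 2 * p * C c + f * C c ^ 2 := by
      rw [dvd_iff_isRoot, IsRoot.def]
      simpa using hc
    rw [Multiset.map_cons, Multiset.prod_cons,
      show (p + f * C c) ^ 2 - X = (k + 2 * p * C c + f * C c ^ 2) * f by
        linear_combination hk]
    exact mul_dvd_mul_right hroot f

/-- An injective endomorphism of a finite-dimensional vector space over an algebraically closed
field of characteristic not two has a square root which is a polynomial in it. -/
theorem exists_aeval_sq_eq {K V : Type*} [Field K] [IsAlgClosed K] (h2 : (2 : K) ≠ 0)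
    [AddCommGroup V] [Module K V] [FiniteDimensional K V] (A : Module.End K V)
    (hA : Function.Injective A) : ∃ p : K[X], aeval A p ^ 2 = A := by
  have h0 : (0 : K) ∉ (minpoly K A).roots := by
    intro h
    obtain ⟨v, hv⟩ := (Module.End.hasEigenvalue_of_isRoot
      (isRoot_of_mem_roots h)).exists_hasEigenvector
    apply hv.2
    apply hA
    simpa using hv.apply_eq_smul
  obtain ⟨p, hp⟩ := exists_prod_X_sub_C_dvd_sq_sub_X h2 _ h0
  refine ⟨p, ?_⟩
  rw [← (IsAlgClosed.splits (minpoly K A)).eq_prod_roots_of_monic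
    (minpoly.monic (Algebra.IsIntegral.isIntegral A)), minpoly.dvd_iff] at hp
  simpa [sub_eq_zero] using hp

/-- If `A` is self-adjoint for a bilinear form, so is every polynomial in `A`. -/
theorem LinearMap.apply_aeval_of_selfAdjoint {K V : Type*} [Field K] [AddCommGroup V] [Module K V]
    (β : V →ₗ[K] V →ₗ[K] K) (A : Module.End K V) (hA : ∀ u v, β (A u) v = β u (A v))
    (p : K[X]) (u v : V) : β (aeval A p u) v = β u (aeval A p v) := by
  induction p using Polynomial.induction_on' with
  | add p q hp hq => simp [hp, hq]
  | monomial n a =>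
    have h : ∀ u v, β ((A ^ n) u) v = β u ((A ^ n) v) := by
      induction n with
      | zero => simp
      | succ n ih =>
        intro u v
        rw [pow_succ, Module.End.mul_apply, ih, hA, ← Module.End.mul_apply, ← pow_succ', pow_succ]
    simp [aeval_monomial, h]

end SquareRoots

section Forms

variable {Ghat : Type} [Group Ghat]

/-- The bilinear form `B w` of an `L`-representation, for odd `w`, as a bundled bilinear map. -/
def IsHermRep.toBilin {π : Ghat →* ℤˣ} {V : Type} [AddCommGroup V] [Module ℂ V]
    {ρ : Representation ℂ π.ker V} {B : Ghat → V → V → ℂ} (hB : IsLRep π ρ B)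
    {w : Ghat} (hw : π w = -1) : V →ₗ[ℂ] V →ₗ[ℂ] ℂ :=
  LinearMap.mk₂ ℂ (B w) (hB.add_left w hw) (hB.smul_left w hw) (hB.add_right w hw)
    (hB.smul_right w hw)

@[simp]
theorem IsHermRep.toBilin_apply {π : Ghat →* ℤˣ} {V : Type} [AddCommGroup V] [Module ℂ V]
    {ρ : Representation ℂ π.ker V} {B : Ghat → V → V → ℂ} (hB : IsLRep π ρ B)
    {w : Ghat} (hw : π w = -1) (u v : V) : hB.toBilin hw u v = B w u v :=
  rfl

theorem conjKer_surjective (π : Ghat →* ℤˣ) (w : Ghat) : Function.Surjective (conjKer π w) :=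
  fun g => ⟨conjKer π w⁻¹ g, Subtype.ext (by simp [conjKer, mul_assoc])⟩

/-- An `L`-representation structure can be transported along an isomorphism of modules. -/
theorem IsHermRep.comap {π : Ghat →* ℤˣ} {V V' : Type} [AddCommGroup V] [Module ℂ V]
    [AddCommGroup V'] [Module ℂ V'] {ρ : Representation ℂ π.ker V}
    {ρ' : Representation ℂ π.ker V'} {B' : Ghat → V' → V' → ℂ} (hB' : IsLRep π ρ' B')
    (e : V ≃ₗ[ℂ] V') (he : ∀ (g : π.ker) (v : V), e (ρ g v) = ρ' g (e v)) :
    IsLRep π ρ fun w u v => B' w (e u) (e v) where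
  add_left w hw u u' v := by rw [map_add, hB'.add_left w hw]
  smul_left w hw a u v := by rw [map_smul, hB'.smul_left w hw]
  add_right w hw u v v' := by rw [map_add, hB'.add_right w hw]
  smul_right w hw a u v := by rw [map_smul, hB'.smul_right w hw]
  nondeg_left w hw u h := e.map_eq_zero_iff.1 <| hB'.nondeg_left w hw _ fun v => by
    simpa using h (e.symm v)
  nondeg_right w hw v h := e.map_eq_zero_iff.1 <| hB'.nondeg_right w hw _ fun u => by
    simpa using h (e.symm u)
  invariant w hw g u v := by rw [he, he, hB'.invariant w hw]
  hermitian w hw u v := by rw [he, hB'.hermitian w hw]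
  compat w₁ w₂ h₁ h₂ u v := by rw [he, ← hB'.compat w₁ w₂ h₁ h₂]

/-- Two `L`-representation structures on the same module differ, at a given odd `w`, by an
invertible operator. -/
theorem IsHermRep.exists_comparison {π : Ghat →* ℤˣ} {V : Type} [AddCommGroup V] [Module ℂ V]
    [FiniteDimensional ℂ V] {ρ : Representation ℂ π.ker V} {B C : Ghat → V → V → ℂ}
    (hB : IsLRep π ρ B) (hC : IsLRep π ρ C) {w : Ghat} (hw : π w = -1) :
    ∃ A : V ≃ₗ[ℂ] V, ∀ u v, B w u (A v) = C w u v := by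
  have injective_flip : ∀ {D : Ghat → V → V → ℂ} (hD : IsLRep π ρ D),
      Function.Injective (hD.toBilin hw).flip := fun hD =>
    (injective_iff_map_eq_zero _).2 fun v hv => hD.nondeg_right w hw v fun u => by
      simpa using LinearMap.congr_fun hv u
  have hdim : Module.finrank ℂ V = Module.finrank ℂ (V →ₗ[ℂ] ℂ) :=
    Subspace.dual_finrank_eq.symm
  let β := LinearEquiv.ofInjectiveOfFinrankEq _ (injective_flip hB) hdim
  let γ := LinearEquiv.ofInjectiveOfFinrankEq _ (injective_flip hC) hdim
  refine ⟨γ.trans β.symm, fun u v => ?_⟩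
  exact LinearMap.congr_fun (β.apply_symm_apply (γ v)) u

/-- Two `L`-representation structures on the same `ℂG`-module are isomorphic. -/
theorem IsHermRep.exists_isometry {π : Ghat →* ℤˣ} (hπ : Function.Surjective π)
    {V : Type} [AddCommGroup V] [Module ℂ V]
    [FiniteDimensional ℂ V] {ρ : Representation ℂ π.ker V} {B C : Ghat → V → V → ℂ}
    (hB : IsLRep π ρ B) (hC : IsLRep π ρ C) :
    ∃ S : V ≃ₗ[ℂ] V, (∀ (g : π.ker) (v : V), S (ρ g v) = ρ g (S v)) ∧
      ∀ w, π w = -1 → ∀ u v : V, B w (S u) (S v) = C w u v := by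
  obtain ⟨w, hw⟩ := hπ (-1)
  obtain ⟨A, hA⟩ := hB.exists_comparison hC hw
  have eq_of_form : ∀ x y : V, (∀ u, B w u x = B w u y) → x = y := fun x y h =>
    (injective_iff_map_eq_zero (hB.toBilin hw).flip).2
      (fun v hv => hB.nondeg_right w hw v fun u => by simpa using LinearMap.congr_fun hv u)
      (LinearMap.ext h)
  have hAρ : ∀ (g : π.ker) (v : V), A (ρ g v) = ρ g (A v) := by
    intro g v
    obtain ⟨h, rfl⟩ := conjKer_surjective π w g
    refine eq_of_form _ _ fun u => ?_
    obtain ⟨u, rfl⟩ := ρ.apply_bijective h |>.surjective u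
    rw [hA, hC.invariant w hw, hB.invariant w hw, hA]
  have hself : ∀ u v, B w (A u) v = B w u (A v) := by
    intro u v
    obtain ⟨v, rfl⟩ := ρ.apply_bijective (sqKer π w) |>.surjective v
    rw [hB.hermitian w hw, hA, hA, hC.hermitian w hw]
  obtain ⟨p, hp⟩ := exists_aeval_sq_eq two_ne_zero (A : Module.End ℂ V) A.injective
  set S : Module.End ℂ V := Polynomial.aeval (A : Module.End ℂ V) p
  have hSS : ∀ v, S (S v) = A v := fun v => by
    rw [← Module.End.mul_apply, ← pow_two, hp]
    rfl
  have hSinj : Function.Injective S := fun x y h => A.injective (by rw [← hSS, ← hSS, h])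
  have hSρ : ∀ (g : π.ker) (v : V), S (ρ g v) = ρ g (S v) := by
    intro g v
    have hcomm : Commute (A : Module.End ℂ V) (ρ g) := LinearMap.ext fun v => hAρ g v
    have hScomm : Commute S (ρ g) := Algebra.commute_of_mem_adjoin_singleton_of_commute
      (Polynomial.aeval_mem_adjoin_singleton ℂ _) hcomm.symm |>.symm
    exact LinearMap.congr_fun hScomm v
  have hw_isom : ∀ u v, B w (S u) (S v) = C w u v := fun u v => by
    rw [← hA, ← hSS]
    exact (hB.toBilin hw).apply_aeval_of_selfAdjoint A hself p u (S v)
  refine ⟨LinearEquiv.ofInjectiveEndo S hSinj, hSρ, fun w' hw' u v => ?_⟩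
  change B w' (S u) (S v) = C w' u v
  rw [hB.compat w' w hw' hw, hC.compat w' w hw' hw, ← hSρ, hw_isom]

end Forms

/-- An `L`-representation is determined up to isomorphism by its underlying `ℂG`-module: if the
underlying modules are `G`-equivariantly isomorphic, the `L`-representations are isomorphic. -/
theorem L_rep_determined_by_module
    {Ghat : Type} [Group Ghat] [Finite Ghat] (π : Ghat →* ℤˣ)
    (hπ : Function.Surjective π)
    {V V' : Type} [AddCommGroup V] [Module ℂ V] [FiniteDimensional ℂ V]
    [AddCommGroup V'] [Module ℂ V'] [FiniteDimensional ℂ V']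
    (ρ : Representation ℂ π.ker V) (ρ' : Representation ℂ π.ker V')
    (B : Ghat → V → V → ℂ) (B' : Ghat → V' → V' → ℂ)
    (hB : IsLRep π ρ B) (hB' : IsLRep π ρ' B')
    (hmodiso : ∃ e : V ≃ₗ[ℂ] V', ∀ (g : π.ker) (v : V), e (ρ g v) = ρ' g (e v)) :
    ∃ e : V ≃ₗ[ℂ] V', (∀ (g : π.ker) (v : V), e (ρ g v) = ρ' g (e v)) ∧
      ∀ w, π w = -1 → ∀ u v : V, B' w (e u) (e v) = B w u v := by
  obtain ⟨e, he⟩ := hmodiso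
  obtain ⟨S, hSρ, hS⟩ := (hB'.comap e he).exists_isometry hπ hB
  refine ⟨S.trans e, fun g v => ?_, fun w hw u v => hS w hw u v⟩
  rw [LinearEquiv.trans_apply, LinearEquiv.trans_apply, hSρ, he]
end

section
/- Let (Ĝ, π) be a C₂-graded finite group, let V be a finite-dimensional A-representation of (Ĝ, π), and let ⟨·,·⟩ be a positive-definite hermitian inner product on V (ℂ-linear in the first argument, conjugate-linear in the second) satisfying ⟨g·u, g·v⟩ = ⟨u, v⟩ for all even g ∈ G and ⟨w·u, w·v⟩ = ⟨v, u⟩ for all odd w ∈ Ĝ \ G and all u, v ∈ V. Then the forms B_w(u, v) := ⟨u, w⁻¹·v⟩ + ⟨v, w·u⟩, for odd w, are nondegenerate bilinear forms that satisfy B_w(g·u, (wgw⁻¹)·v) = B_w(u, v) for all g ∈ G, B_w(u, w²·v) = B_w(v, u), and B_{w₁}(u, v) = B_{w₂}(u, (w₂w₁⁻¹)·v) for all odd w₁, w₂; i.e., they make the underlying ℂG-module of V into an L-representation of (Ĝ, π). -/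
open scoped ComplexConjugate

/-- On an `A`-representation with an invariant form `h`, the two summands of `assocForm` agree. -/
theorem assocForm_eq_two_mul {Ghat : Type} [Group Ghat] {π : Ghat →* ℤˣ}
    {V : Type} [AddCommGroup V] [Module ℂ V] {a : Ghat → V → V} (ha : IsARep π a)
    {h : V → V → ℂ} (h_inv_odd : ∀ w, π w = -1 → ∀ u v : V, h (a w u) (a w v) = h v u)
    {w : Ghat} (hw : π w = -1) (u v : V) :
    assocForm a h w u v = 2 * h u (a w⁻¹ v) := by
  have key := h_inv_odd w hw (a w⁻¹ v) u
  rw [← ha.map_mul, mul_inv_cancel, ha.map_one] at key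
  rw [assocForm, key, two_mul]

/-- From an invariant positive-definite hermitian inner product on an `A`-representation, the
forms `B_w(u,v) = ⟨u, w⁻¹·v⟩ + ⟨v, w·u⟩` are nondegenerate bilinear forms that are `w`-invariant,
`w`-symmetric and compatible; i.e. they make the underlying `ℂG`-module into an
`L`-representation. -/
theorem assocForm_is_L_rep
    {Ghat : Type} [Group Ghat] [Finite Ghat] (π : Ghat →* ℤˣ)
    (hπ : Function.Surjective π)
    {V : Type} [AddCommGroup V] [Module ℂ V] [FiniteDimensional ℂ V]
    (a : Ghat → V → V) (ha : IsARep π a)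
    (h : V → V → ℂ)
    (h_add_left : ∀ u u' v : V, h (u + u') v = h u v + h u' v)
    (h_add_right : ∀ u v v' : V, h u (v + v') = h u v + h u v')
    (h_smul_left : ∀ (c : ℂ) (u v : V), h (c • u) v = c * h u v)
    (h_smul_right : ∀ (c : ℂ) (u v : V), h u (c • v) = (starRingEnd ℂ c) * h u v)
    (h_herm : ∀ u v : V, h v u = starRingEnd ℂ (h u v))
    (h_posdef : ∀ v : V, v ≠ 0 → 0 < (h v v).re)
    (h_inv_even : ∀ g, π g = 1 → ∀ u v : V, h (a g u) (a g v) = h u v)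
    (h_inv_odd : ∀ w, π w = -1 → ∀ u v : V, h (a w u) (a w v) = h v u) :
    (∀ w, π w = -1 →
      (∀ u u' v : V, assocForm a h w (u + u') v = assocForm a h w u v + assocForm a h w u' v) ∧
      (∀ (c : ℂ) (u v : V), assocForm a h w (c • u) v = c * assocForm a h w u v) ∧
      (∀ u v v' : V, assocForm a h w u (v + v') = assocForm a h w u v + assocForm a h w u v') ∧
      (∀ (c : ℂ) (u v : V), assocForm a h w u (c • v) = c * assocForm a h w u v) ∧
      (∀ u : V, (∀ v : V, assocForm a h w u v = 0) → u = 0) ∧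
      (∀ v : V, (∀ u : V, assocForm a h w u v = 0) → v = 0) ∧
      (∀ g, π g = 1 → ∀ u v : V,
        assocForm a h w (a g u) (a (w * g * w⁻¹) v) = assocForm a h w u v) ∧
      (∀ u v : V, assocForm a h w u (a (w * w) v) = assocForm a h w v u)) ∧
    (∀ w₁ w₂, π w₁ = -1 → π w₂ = -1 → ∀ u v : V,
      assocForm a h w₁ u v = assocForm a h w₂ u (a (w₂ * w₁⁻¹) v)) := by
  have eq_zero : ∀ v : V, h v v = 0 → v = 0 := fun v hv => by
    by_contra hne
    simpa [hv] using h_posdef v hne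
  have form_eq : ∀ {w}, π w = -1 → ∀ u v : V, assocForm a h w u v = 2 * h u (a w⁻¹ v) :=
    assocForm_eq_two_mul ha h_inv_odd
  refine ⟨fun w hw => ?_, fun w₁ w₂ hw₁ hw₂ u v => ?_⟩
  · have hw' : π w⁻¹ = -1 := by rw [map_inv, hw, inv_neg, inv_one]
    have inv_act : ∀ v, a w⁻¹ (a w v) = v := fun v => by
      rw [← ha.map_mul, inv_mul_cancel, ha.map_one]
    have act_inv : ∀ v, a w (a w⁻¹ v) = v := fun v => by
      rw [← ha.map_mul, mul_inv_cancel, ha.map_one]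
    refine ⟨fun u u' v => ?_, fun c u v => ?_, fun u v v' => ?_, fun c u v => ?_, fun u hu => ?_,
      fun v hv => ?_, fun g hg u v => ?_, fun u v => ?_⟩
    · simp only [form_eq hw, h_add_left, mul_add]
    · simp only [form_eq hw, h_smul_left]
      ring
    · simp only [form_eq hw, ha.map_add, h_add_right, mul_add]
    · simp only [form_eq hw, ha.map_smul_odd _ hw', h_smul_right, Complex.conj_conj]
      ring
    · have := hu (a w u)
      rw [form_eq hw, inv_act] at this
      exact eq_zero u (by simpa using this)
    · have := hv (a w⁻¹ v)
      rw [form_eq hw] at this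
      rw [← act_inv v, eq_zero (a w⁻¹ v) (by simpa using this)]
      simpa using ha.map_add w 0 0
    · rw [form_eq hw, form_eq hw, ← ha.map_mul, mul_assoc, inv_mul_cancel_left, ha.map_mul,
        h_inv_even g hg]
    · rw [form_eq hw, form_eq hw, ha.map_mul, inv_act, ← h_inv_odd w hw (a w⁻¹ u) v, act_inv]
  · rw [form_eq hw₁, form_eq hw₂, ← ha.map_mul, inv_mul_cancel_left]
end

section
/- Let (Ĝ, π) be a C₂-graded finite group and let (V, ρ) be a finite-dimensional complex representation of G = ker π. Then the ℂ-linear G-action ρ extends to an A-representation of (Ĝ, π) on V (with odd elements acting conjugate-linearly) if and only if there exists a family of nondegenerate bilinear forms (B_w), one for each odd w ∈ Ĝ \ G, making (V, ρ) an L-representation of (Ĝ, π). -/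
open scoped ComplexConjugate

namespace GradedExtension

open Module Polynomial

section RealForms

variable {V : Type*} [AddCommGroup V] [Module ℝ V]

/-- A symmetric positive definite real bilinear form. -/
structure IsInner (b : LinearMap.BilinForm ℝ V) : Prop where
  symm : ∀ u v, b u v = b v u
  pos : ∀ v, v ≠ 0 → 0 < b v v

namespace IsInner

variable {b : LinearMap.BilinForm ℝ V}

lemma ext_left (hb : IsInner b) {u u' : V} (h : ∀ v, b u v = b u' v) : u = u' := by
  by_contra hne
  have h1 := hb.pos (u - u') (sub_ne_zero.mpr hne)
  rw [LinearMap.map_sub₂, h, sub_self] at h1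
  exact h1.false

lemma nondegenerate (hb : IsInner b) : b.Nondegenerate := by
  refine ⟨fun u hu => hb.ext_left fun v => ?_, fun u hu => hb.ext_left fun v => ?_⟩
  · simp [hu v]
  · simp [hb.symm u v, hu v]

/-- The inner product space core given by a symmetric positive definite form. -/
@[reducible]
def core (hb : IsInner b) : InnerProductSpace.Core ℝ V where
  inner u v := b u v
  conj_inner_symm u v := by simpa using hb.symm v u
  re_inner_nonneg v := by
    rcases eq_or_ne v 0 with rfl | hv
    · simp
    · simpa using (hb.pos v hv).le
  add_left u v w := by simp
  smul_left u v r := by simp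
  definite v hv := by
    by_contra hne
    exact (hb.pos v hne).ne' hv

lemma exists_eigenbasis [FiniteDimensional ℝ V] (hb : IsInner b) {P : End ℝ V}
    (hsymm : ∀ u v, b (P u) v = b u (P v)) :
    ∃ (n : ℕ) (e : Basis (Fin n) ℝ V) (μ : Fin n → ℝ), ∀ i, P (e i) = μ i • e i := by
  let : NormedAddCommGroup V := hb.core.toNormedAddCommGroup
  let : InnerProductSpace ℝ V := InnerProductSpace.ofCore hb.core.toCore
  have hP : P.IsSymmetric := fun u v => hsymm u v
  exact ⟨_, (hP.eigenvectorBasis rfl).toBasis, hP.eigenvalues rfl, fun i => by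
    simp [hP.apply_eigenvectorBasis]⟩

end IsInner

lemma commute_aeval {P T : End ℝ V} (h : Commute P T) (q : ℝ[X]) : Commute (aeval P q) T := by
  induction q using Polynomial.induction_on' with
  | add p q hp hq => simpa using hp.add_left hq
  | monomial n a =>
    rw [aeval_monomial]
    exact (Algebra.commute_algebraMap_left a T).mul_left (h.pow_left n)

/-- A positive symmetric operator has an inverse square root in its bicommutant. -/
lemma IsInner.exists_inv_sqrt [FiniteDimensional ℝ V] {b : LinearMap.BilinForm ℝ V}
    (hb : IsInner b) {P : End ℝ V} (hsymm : ∀ u v, b (P u) v = b u (P v))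
    (hpos : ∀ v, v ≠ 0 → 0 < b (P v) v) :
    ∃ S : End ℝ V, (∀ T, Commute P T → Commute S T) ∧ S * S * P = 1 := by
  obtain ⟨n, e, μ, he⟩ := hb.exists_eigenbasis hsymm
  have hμ (i : Fin n) : 0 < μ i := by
    have h1 := hpos (e i) (e.ne_zero i)
    rw [he, map_smul, LinearMap.smul_apply, smul_eq_mul] at h1
    exact pos_of_mul_pos_left h1 (hb.pos _ (e.ne_zero i)).le
  let q : ℝ[X] := Lagrange.interpolate (Finset.univ.image μ) id fun x => (√x)⁻¹
  have hq (i : Fin n) : q.eval (μ i) = (√(μ i))⁻¹ :=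
    Lagrange.eval_interpolate_at_node (v := id) (i := μ i) _ Function.injective_id.injOn
      (Finset.mem_image_of_mem μ (Finset.mem_univ i))
  refine ⟨aeval P q, fun T hT => commute_aeval hT q, e.ext fun i => ?_⟩
  have hS : aeval P q (e i) = (√(μ i))⁻¹ • e i := by
    rw [Module.End.aeval_apply_of_mem_apply_eq_smul (p := q) (he i), hq]
  simp only [Module.End.mul_apply, he, map_smul, hS, smul_smul, Module.End.one_apply]
  have h2 := Real.mul_self_sqrt (hμ i).le
  have h3 := (Real.sqrt_pos.mpr (hμ i)).ne'
  rw [show μ i * ((√(μ i))⁻¹ * (√(μ i))⁻¹) = 1 by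
    rw [← mul_inv, h2, mul_inv_cancel₀ (hμ i).ne'], one_smul]

end RealForms

section Hermitian

variable {V : Type*} [AddCommGroup V] [Module ℂ V]

lemma exists_inner_I_invariant [FiniteDimensional ℂ V] :
    ∃ b : LinearMap.BilinForm ℝ V, IsInner b ∧
      ∀ u v, b (Complex.I • u) (Complex.I • v) = b u v := by
  let e := (Module.finBasis ℂ V).equivFun
  have he (c : ℝ) (u : V) (i) : e (c • u) i = c * e u i := by
    rw [← Complex.coe_smul, map_smul, Pi.smul_apply, smul_eq_mul]
  let b : LinearMap.BilinForm ℝ V := LinearMap.mk₂ ℝ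
    (fun u v => ∑ i, ((e u i).re * (e v i).re + (e u i).im * (e v i).im))
    (fun u u' v => by
      rw [← Finset.sum_add_distrib]
      exact Finset.sum_congr rfl fun i _ => by simp; ring)
    (fun c u v => by
      rw [smul_eq_mul, Finset.mul_sum]
      exact Finset.sum_congr rfl fun i _ => by simp [he]; ring)
    (fun u v v' => by
      rw [← Finset.sum_add_distrib]
      exact Finset.sum_congr rfl fun i _ => by simp; ring)
    (fun c u v => by
      rw [smul_eq_mul, Finset.mul_sum]
      exact Finset.sum_congr rfl fun i _ => by simp [he]; ring)
  have hb (u v : V) :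
      b u v = ∑ i, ((e u i).re * (e v i).re + (e u i).im * (e v i).im) := rfl
  refine ⟨b, ⟨fun u v => ?_, fun v hv => ?_⟩, fun u v => ?_⟩
  · simp only [hb]
    exact Finset.sum_congr rfl fun i _ => by ring
  · rw [hb]
    obtain ⟨i, hi⟩ : ∃ i, e v i ≠ 0 := by
      by_contra! h
      exact hv (e.injective (by rw [map_zero]; exact funext h))
    refine Finset.sum_pos' (fun j _ => by nlinarith [sq_nonneg (e v j).re]) ⟨i, by simp, ?_⟩
    simpa [Complex.normSq_apply] using Complex.normSq_pos.mpr hi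
  · simp only [hb]
    exact Finset.sum_congr rfl fun i _ => by simp; ring

/-- Averaging: a real representation of a finite group whose elements act linearly or
conjugate-linearly preserves a symmetric positive definite form that is invariant under
multiplication by `I`. -/
lemma exists_invariant_inner [FiniteDimensional ℂ V] {Γ : Type*} [Group Γ] [Finite Γ]
    (σ : Representation ℝ Γ V)
    (hσ : ∀ g, (∀ v, σ g (Complex.I • v) = Complex.I • σ g v) ∨
      ∀ v, σ g (Complex.I • v) = -(Complex.I • σ g v)) :
    ∃ b : LinearMap.BilinForm ℝ V, IsInner b ∧
      (∀ u v, b (Complex.I • u) (Complex.I • v) = b u v) ∧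
      ∀ g u v, b (σ g u) (σ g v) = b u v := by
  cases nonempty_fintype Γ
  obtain ⟨b₀, hb₀, hI⟩ := exists_inner_I_invariant (V := V)
  have key (u v : V) : (∑ g, b₀.compl₁₂ (σ g) (σ g)) u v = ∑ g, b₀ (σ g u) (σ g v) := by
    simp [LinearMap.sum_apply]
  have hinj (g : Γ) {v : V} (hv : v ≠ 0) : σ g v ≠ 0 := fun h => hv <| by
    simpa [← Module.End.mul_apply, ← map_mul] using congrArg (σ g⁻¹) h
  refine ⟨∑ g, b₀.compl₁₂ (σ g) (σ g), ⟨fun u v => ?_, fun v hv => ?_⟩, fun u v => ?_,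
    fun g u v => ?_⟩
  · simp only [key]
    exact Finset.sum_congr rfl fun g _ => hb₀.symm _ _
  · rw [key]
    exact Finset.sum_pos (fun g _ => hb₀.pos _ (hinj g hv)) ⟨1, by simp⟩
  · simp only [key]
    refine Finset.sum_congr rfl fun g _ => ?_
    rcases hσ g with h | h <;> simp [h, hI]
  · simp only [key]
    refine Fintype.sum_equiv (Equiv.mulRight g) _ _ fun x => ?_
    simp [map_mul, Module.End.mul_apply]

lemma complex_smul (c : ℂ) (v : V) : c • v = c.re • v + c.im • Complex.I • v := by
  conv_lhs => rw [← Complex.re_add_im c, add_smul, mul_smul, Complex.coe_smul, Complex.coe_smul]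

lemma I_smul_I_smul (v : V) : Complex.I • Complex.I • v = -v := by
  rw [smul_smul, Complex.I_mul_I, neg_one_smul]

lemma map_smul_of_map_neg_I {f : End ℝ V} (hf : ∀ v, f (Complex.I • v) = -(Complex.I • f v))
    (c : ℂ) (v : V) : f (c • v) = (starRingEnd ℂ c) • f v := by
  rw [complex_smul, complex_smul _ (f v), map_add, map_smul, map_smul, hf]
  simp

/-- Multiplication by `I` as a real endomorphism. -/
def mulI (V : Type*) [AddCommGroup V] [Module ℂ V] : End ℝ V :=
  (Complex.I • LinearMap.id : V →ₗ[ℂ] V).restrictScalars ℝ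

@[simp]
lemma mulI_apply (v : V) : mulI V v = Complex.I • v := rfl

lemma I_left {b : LinearMap.BilinForm ℝ V}
    (hI : ∀ u v, b (Complex.I • u) (Complex.I • v) = b u v) (u v : V) :
    b (Complex.I • u) v = -b u (Complex.I • v) := by
  rw [← hI, I_smul_I_smul, map_neg, LinearMap.neg_apply]

/-- The complex form, linear in the second variable, with real part `b`. -/
def complexify (b : LinearMap.BilinForm ℝ V) (u v : V) : ℂ :=
  ⟨b u v, -b u (Complex.I • v)⟩

section complexify

variable {b : LinearMap.BilinForm ℝ V}

lemma complexify_add_left (u u' v : V) :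
    complexify b (u + u') v = complexify b u v + complexify b u' v := by
  apply Complex.ext <;> simp [complexify]; ring

lemma complexify_add_right (u v v' : V) :
    complexify b u (v + v') = complexify b u v + complexify b u v' := by
  apply Complex.ext <;> simp [complexify]; ring

lemma complexify_smul_right (c : ℂ) (u v : V) :
    complexify b u (c • v) = c * complexify b u v := by
  rw [complex_smul]
  apply Complex.ext <;>
    simp [complexify, smul_comm Complex.I (_ : ℝ) v, smul_comm Complex.I (_ : ℝ) (Complex.I • v),
      I_smul_I_smul]
  ring

variable (hI : ∀ u v, b (Complex.I • u) (Complex.I • v) = b u v)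

include hI in
lemma complexify_conj (hb : IsInner b) (u v : V) :
    starRingEnd ℂ (complexify b u v) = complexify b v u := by
  apply Complex.ext
  · simpa [complexify] using hb.symm u v
  · simp [complexify, ← I_left hI, hb.symm]

end complexify

end Hermitian

section Graded

variable {Ghat : Type} [Group Ghat] {π : Ghat →* ℤˣ}
  {V : Type} [AddCommGroup V] [Module ℂ V] {ρ : Representation ℂ π.ker V}

lemma even_or_odd (π : Ghat →* ℤˣ) (z : Ghat) : π z = 1 ∨ π z = -1 :=
  Int.units_eq_one_or _

/-- An antilinear representation, as a real representation of the whole group. -/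
def realRep {a : Ghat → V → V} (ha : IsARep π a) : Representation ℝ Ghat V where
  toFun z :=
    { toFun := a z
      map_add' := ha.map_add z
      map_smul' := fun r v => by
        rcases even_or_odd π z with h | h
        · simpa using ha.map_smul_even z h r v
        · simpa using ha.map_smul_odd z h r v }
  map_one' := LinearMap.ext ha.map_one
  map_mul' z₁ z₂ := LinearMap.ext (ha.map_mul z₁ z₂)

@[simp]
lemma realRep_apply {a : Ghat → V → V} (ha : IsARep π a) (z : Ghat) (v : V) :
    realRep ha z v = a z v := rfl

/-- A complex representation with scalars restricted to the reals. -/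
def restrictReal {Γ : Type*} [Group Γ] (ρ : Representation ℂ Γ V) : Representation ℝ Γ V where
  toFun g := (ρ g).restrictScalars ℝ
  map_one' := by ext; simp
  map_mul' g h := by ext; simp

@[simp]
lemma restrictReal_apply {Γ : Type*} [Group Γ] (ρ : Representation ℂ Γ V) (g : Γ) (v : V) :
    restrictReal ρ g v = ρ g v := rfl

theorem exists_isLRep_of_isARep [Finite Ghat] [FiniteDimensional ℂ V] {a : Ghat → V → V}
    (ha : IsARep π a) (haρ : ∀ (g : π.ker) (v : V), a (g : Ghat) v = ρ g v) :
    ∃ B : Ghat → V → V → ℂ, IsLRep π ρ B := by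
  obtain ⟨b, hb, hI, hinv⟩ := exists_invariant_inner (realRep ha) fun z => by
    rcases even_or_odd π z with h | h
    · exact .inl fun v => ha.map_smul_even z h _ v
    · exact .inr fun v => by simp [ha.map_smul_odd z h]
  simp only [realRep_apply] at hinv
  have hodd (w : Ghat) (hw : π w = -1) (u v : V) :
      complexify b (a w u) (a w v) = starRingEnd ℂ (complexify b u v) := by
    have h : Complex.I • a w v = -a w (Complex.I • v) := by simp [ha.map_smul_odd w hw]
    apply Complex.ext <;> simp [complexify, h, hinv]
  have heven (g : Ghat) (hg : π g = 1) (u v : V) :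
      complexify b (a g u) (a g v) = complexify b u v := by
    apply Complex.ext <;> simp [complexify, ← ha.map_smul_even g hg, hinv]
  have hsmul (c : ℂ) (u v : V) :
      complexify b (starRingEnd ℂ c • u) v = c * complexify b u v := by
    rw [← complexify_conj hI hb, complexify_smul_right, map_mul, Complex.conj_conj,
      complexify_conj hI hb]
  have hcancel (w : Ghat) (u : V) : a w (a w⁻¹ u) = u := by
    rw [← ha.map_mul, mul_inv_cancel, ha.map_one]
  have hcancel' (w : Ghat) (u : V) : a w⁻¹ (a w u) = u := by
    rw [← ha.map_mul, inv_mul_cancel, ha.map_one]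
  have hzero {v : V} (h : complexify b v v = 0) : v = 0 := by
    by_contra hv
    have hre : (complexify b v v).re = 0 := by rw [h, Complex.zero_re]
    exact (hb.pos v hv).ne' hre
  refine ⟨fun w u v => complexify b (a w u) v, ?_⟩
  constructor
  · intro w _ u u' v
    simp only [ha.map_add, complexify_add_left]
  · intro w hw c u v
    simp only [ha.map_smul_odd w hw, hsmul, RingHom.id_apply]
  · intro w _ u v v'
    exact complexify_add_right _ _ _
  · intro w _ c u v
    exact complexify_smul_right _ _ _
  · intro w _ u hu
    have h := hzero (hu (a w u))
    rw [← hcancel' w u, h]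
    simpa using (realRep ha w⁻¹).map_zero
  · intro w _ v hv
    exact hzero (by simpa only [hcancel] using hv (a w⁻¹ v))
  · intro w _ g u v
    have h : a w (ρ g u) = a (conjKer π w g : Ghat) (a w u) := by
      rw [← haρ, ← ha.map_mul, ← ha.map_mul]
      congr 1
      simp [conjKer]
    simp only [h, ← haρ (conjKer π w g)]
    exact heven _ (conjKer π w g).2 _ _
  · intro w hw u v
    have h : ρ (sqKer π w) v = a w (a w v) := by
      rw [← haρ, ← ha.map_mul]
      rfl
    simp only [h, hodd w hw, complexify_conj hI hb, RingHom.id_apply]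
  · intro w₁ w₂ h₁ h₂ u v
    have h : ρ (ratioKer π w₂ w₁ h₂ h₁) v = a w₂ (a w₁⁻¹ v) := by
      rw [← haρ, ← ha.map_mul]
      rfl
    simp only [h, hodd w₂ h₂]
    rw [← hodd w₁ h₁, hcancel]

/-- A conjugate-linear operator `A` that intertwines `ρ` with its conjugate by an odd element `w`
and squares to the action of `w²` extends `ρ` to an antilinear representation. -/
theorem exists_isARep_of_antilinear {w : Ghat} (hw : π w = -1) (A : End ℝ V)
    (hAI : ∀ v, A (Complex.I • v) = -(Complex.I • A v))
    (hAρ : ∀ g v, A (ρ g v) = ρ (conjKer π w g) (A v))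
    (hAA : ∀ v, A (A v) = ρ (sqKer π w) v) :
    ∃ a : Ghat → V → V, IsARep π a ∧ ∀ (g : π.ker) (v : V), a (g : Ghat) v = ρ g v := by
  have hne : ¬ ((-1 : ℤˣ) = 1) := by decide
  have hmem {z : Ghat} (hz : π z = -1) : z * w⁻¹ ∈ π.ker := by
    simp [MonoidHom.mem_ker, hz, hw]
  have hρ {g h k : π.ker} (e : (g : Ghat) = h * k) (v : V) : ρ g v = ρ h (ρ k v) := by
    rw [show g = h * k from Subtype.ext e, map_mul, Module.End.mul_apply]
  have hodd {z : Ghat} (hz : ¬ π z = 1) : π z = -1 := (even_or_odd π z).resolve_left hz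
  let a : Ghat → V → V := fun z v =>
    if h : π z = 1 then ρ ⟨z, h⟩ v else ρ ⟨z * w⁻¹, hmem (hodd h)⟩ (A v)
  have a_even {z : Ghat} (h : π z = 1) (v : V) : a z v = ρ ⟨z, h⟩ v := dif_pos h
  have a_odd {z : Ghat} (h : π z = -1) (v : V) : a z v = ρ ⟨z * w⁻¹, hmem h⟩ (A v) :=
    dif_neg (by rw [h]; exact hne)
  refine ⟨a, ⟨fun z u v => ?_, fun z hz c v => ?_, fun z hz c v => ?_, fun v => ?_,
    fun z₁ z₂ v => ?_⟩, fun g v => a_even g.2 v⟩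
  · rcases even_or_odd π z with h | h
    · simp only [a_even h, map_add]
    · simp only [a_odd h, map_add]
  · simp only [a_even hz, map_smul]
  · simp only [a_odd hz, map_smul_of_map_neg_I hAI, map_smul]
  · rw [a_even (map_one π)]
    exact congrArg (fun f => f v) (map_one ρ)
  · rcases even_or_odd π z₁ with h₁ | h₁ <;> rcases even_or_odd π z₂ with h₂ | h₂
    · rw [a_even h₁, a_even h₂, a_even (by simp [h₁, h₂])]
      exact hρ rfl v
    · rw [a_even h₁, a_odd h₂, a_odd (by simp [h₁, h₂])]
      exact hρ (by simp [mul_assoc]) _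
    · rw [a_odd h₁, a_even h₂, a_odd (by simp [h₁, h₂]), hAρ]
      exact hρ (by simp [conjKer, mul_assoc]) _
    · rw [a_odd h₁, a_odd h₂, a_even (by simp [h₁, h₂]), hAρ, hAA,
        ← hρ (g := conjKer π w ⟨z₂ * w⁻¹, hmem h₂⟩ * sqKer π w) rfl]
      exact hρ (by simp [conjKer, sqKer, mul_assoc]) _

theorem exists_isARep_of_isLRep [Finite Ghat] [FiniteDimensional ℂ V] {B : Ghat → V → V → ℂ}
    (hB : IsLRep π ρ B) {w : Ghat} (hw : π w = -1) :
    ∃ a : Ghat → V → V, IsARep π a ∧ ∀ (g : π.ker) (v : V), a (g : Ghat) v = ρ g v := by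
  obtain ⟨b, hb, hI, hinv⟩ := exists_invariant_inner (restrictReal ρ) fun g => .inl fun v => by
    simp
  simp only [restrictReal_apply] at hinv
  have : FiniteDimensional ℝ V := FiniteDimensional.complexToReal V
  let C : LinearMap.BilinForm ℝ V := LinearMap.mk₂ ℝ (fun u v => (B w u v).re)
    (fun u u' v => by rw [hB.add_left w hw, Complex.add_re])
    (fun r u v => by rw [← Complex.coe_smul, hB.smul_left w hw]; simp)
    (fun u v v' => by rw [hB.add_right w hw, Complex.add_re])
    (fun r u v => by rw [← Complex.coe_smul, hB.smul_right w hw]; simp)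
  let J : End ℝ V := (LinearMap.BilinForm.toDual b hb.nondegenerate).symm.toLinearMap ∘ₗ C
  have hJ (u v : V) : b (J u) v = (B w u v).re :=
    LinearMap.BilinForm.apply_toDual_symm_apply (hB := hb.nondegenerate) (C u) v
  have hJ0 {u : V} (hu : u ≠ 0) : J u ≠ 0 := fun h => hu <| by
    refine hB.nondeg_left w hw u fun v => ?_
    have h1 (v : V) : (B w u v).re = 0 := by rw [← hJ, h]; simp
    refine Complex.ext (h1 v) ?_
    simpa [hB.smul_right w hw] using h1 (Complex.I • v)
  have hJI (u : V) : J (Complex.I • u) = -(Complex.I • J u) := hb.ext_left fun v => by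
    rw [hJ, map_neg, LinearMap.neg_apply, I_left hI, hJ, hB.smul_left w hw, hB.smul_right w hw]
    simp
  have hJρ (g : π.ker) (u : V) : J (ρ g u) = ρ (conjKer π w g) (J u) := hb.ext_left fun v => by
    have h : v = ρ (conjKer π w g) (ρ (conjKer π w g)⁻¹ v) := by simp
    rw [h, hinv, hJ, hB.invariant w hw, hJ]
  have hJs (u v : V) : b (J u) (ρ (sqKer π w) v) = b (J v) u := by
    rw [hJ, hJ, hB.hermitian w hw, RingHom.id_apply]
  let R := restrictReal ρ
  let s := sqKer π w
  let P : End ℝ V := R s⁻¹ * J * J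
  have hP (v : V) : P v = ρ s⁻¹ (J (J v)) := rfl
  have hsJ (v : V) : J (ρ s⁻¹ v) = ρ s⁻¹ (J v) := by
    rw [hJρ]
    congr 2
    exact Subtype.ext (by simp [conjKer, s, sqKer])
  have hbP (u v : V) : b (P u) v = b (J u) (J v) := by
    have h := hJs v (ρ s⁻¹ (J u))
    rw [show ρ (sqKer π w) (ρ s⁻¹ (J u)) = J u by simp [s], hsJ] at h
    rw [hP, ← h, hb.symm]
  obtain ⟨S, hScomm, hS⟩ := hb.exists_inv_sqrt (P := P)
    (fun u v => by rw [hbP, hb.symm u, hbP, hb.symm])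
    (fun v hv => by rw [hbP]; exact hb.pos _ (hJ0 hv))
  have hSJ (v : V) : S (J v) = J (S v) :=
    LinearMap.congr_fun (hScomm J (LinearMap.ext fun v => by
      simp only [Module.End.mul_apply, hP, hsJ])) v
  have hSI (v : V) : S (Complex.I • v) = Complex.I • S v :=
    LinearMap.congr_fun (hScomm (mulI V) (LinearMap.ext fun v => by
      simp [Module.End.mul_apply, hP, hJI])) v
  have hSρ (g : π.ker) (v : V) : S (ρ g v) = ρ g (S v) :=
    LinearMap.congr_fun (hScomm (R g) (LinearMap.ext fun v => by
      simp only [Module.End.mul_apply, hP, R, restrictReal_apply, hJρ]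
      rw [← Module.End.mul_apply, ← Module.End.mul_apply (ρ g), ← map_mul, ← map_mul]
      congr 2
      exact Subtype.ext (by simp [conjKer, s, sqKer, mul_assoc]))) v
  refine exists_isARep_of_antilinear hw (S * J) (fun v => ?_) (fun g v => ?_) fun v => ?_
  · simp [hJI, hSI]
  · simp only [Module.End.mul_apply, hJρ, hSρ]
  · have h : J (J v) = ρ s (P v) := by simp [hP]
    have h1 : S (S (P v)) = v := LinearMap.congr_fun hS v
    simp only [Module.End.mul_apply]
    rw [← hSJ, h, hSρ, hSρ, h1]

end Graded

end GradedExtension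

/-- A `ℂG`-module extends to an `A`-representation of the `C₂`-graded group if and only if it
extends to an `L`-representation. -/
theorem extends_A_iff_extends_L
    {Ghat : Type} [Group Ghat] [Finite Ghat] (π : Ghat →* ℤˣ)
    (hπ : Function.Surjective π)
    {V : Type} [AddCommGroup V] [Module ℂ V] [FiniteDimensional ℂ V]
    (ρ : Representation ℂ π.ker V) :
    (∃ a : Ghat → V → V, IsARep π a ∧ ∀ (g : π.ker) (v : V), a (g : Ghat) v = ρ g v) ↔
    (∃ B : Ghat → V → V → ℂ, IsLRep π ρ B) := by
  constructor
  · rintro ⟨a, ha, haρ⟩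
    exact GradedExtension.exists_isLRep_of_isARep ha haρ
  · rintro ⟨B, hB⟩
    obtain ⟨w, hw⟩ := hπ (-1)
    exact GradedExtension.exists_isARep_of_isLRep hB hw
end
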